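/- arXiv:1607.02009 — 12 statements merged into one kernel-verified Lean document; each statement's English description precedes it below -/
import Mathlib

section
/- (Upper bounding the SRIP via the mutual coherence.) Let D be a real N×M matrix with normalized columns (‖d_j‖₂ = 1 for all j) and mutual coherence bound μ (|⟨d_i,d_j⟩| ≤ μ for i ≠ j). Let T ⊆ {1,…,M} be a support such that for every j ∈ T the number of t ∈ T with t ≠ j and ⟨d_t,d_j⟩ ≠ 0 is at most k − 1. Then for every vector Δ ∈ ℝ^T, (1 − (k−1)μ)‖Δ‖₂² ≤ ‖D_T Δ‖₂² ≤ (1 + (k−1)μ)‖Δ‖₂². In particular the Stripe-RIP constant δ_k of D satisfies δ_k ≤ (k−1)μ. -/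
/-- Schur test for a quadratic form: if the coefficients are dominated by a symmetric nonnegative
kernel whose row sums are at most `r` wherever `v` is nonzero, the form is bounded by
`r * ∑ i, v i ^ 2`. -/
theorem abs_quadratic_form_le_of_row_sum_le {ι : Type*} [Fintype ι] (A c : ι → ι → ℝ) (v : ι → ℝ)
    (r : ℝ) (hsymm : ∀ i j, c i j = c j i)
    (hA : ∀ i j, |v i * v j * A i j| ≤ |v i * v j| * c i j) (hc : ∀ i j, 0 ≤ c i j)
    (hrow : ∀ i, v i ≠ 0 → ∑ j, c i j ≤ r) :
    |∑ i, ∑ j, v i * v j * A i j| ≤ r * ∑ i, v i ^ 2 := by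
  have amgm (i j : ι) : |v i * v j| ≤ (v i ^ 2 + v j ^ 2) / 2 := by
    rw [abs_le]
    constructor <;> nlinarith [sq_nonneg (v i + v j), sq_nonneg (v i - v j)]
  have hswap : ∑ i, ∑ j, v j ^ 2 * c i j = ∑ i, ∑ j, v i ^ 2 * c i j := by
    rw [Finset.sum_comm]
    exact Finset.sum_congr rfl fun i _ => Finset.sum_congr rfl fun j _ => by rw [hsymm]
  calc |∑ i, ∑ j, v i * v j * A i j|
      ≤ ∑ i, ∑ j, |v i * v j * A i j| :=
        (Finset.abs_sum_le_sum_abs _ _).trans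
          (Finset.sum_le_sum fun i _ => Finset.abs_sum_le_sum_abs _ _)
    _ ≤ ∑ i, ∑ j, (v i ^ 2 * c i j + v j ^ 2 * c i j) / 2 := by
        refine Finset.sum_le_sum fun i _ => Finset.sum_le_sum fun j _ => (hA i j).trans ?_
        linarith [mul_le_mul_of_nonneg_right (amgm i j) (hc i j)]
    _ = ∑ i, v i ^ 2 * ∑ j, c i j := by
        simp only [← Finset.sum_div, Finset.sum_add_distrib, hswap, Finset.mul_sum]
        ring
    _ ≤ ∑ i, r * v i ^ 2 := by
        refine Finset.sum_le_sum fun i _ => ?_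
        by_cases hi : v i = 0
        · simp [hi]
        · rw [mul_comm r]
          exact mul_le_mul_of_nonneg_left (hrow i hi) (sq_nonneg _)
    _ = r * ∑ i, v i ^ 2 := by rw [Finset.mul_sum]

/-- The squared norm of `D v` as the quadratic form of the Gram matrix. -/
theorem sum_sq_mulVec_eq_gram {m n : Type*} [Fintype m] [Fintype n] (D : Matrix m n ℝ)
    (v : n → ℝ) :
    ∑ x, (D.mulVec v x) ^ 2 = ∑ i, ∑ j, v i * v j * ∑ x, D x i * D x j := by
  simp_rw [Matrix.mulVec, dotProduct, sq, Finset.sum_mul_sum, Finset.mul_sum]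
  rw [Finset.sum_comm]
  refine Finset.sum_congr rfl fun i _ => ?_
  rw [Finset.sum_comm]
  exact Finset.sum_congr rfl fun j _ => Finset.sum_congr rfl fun x _ => by ring


/-- Upper bounding the Stripe-RIP via the mutual coherence: for any support `T` with stripe
overlap bound `k` and any vector `Δ` supported on `T`,
`(1 - (k-1)μ)‖Δ‖₂² ≤ ‖D_T Δ‖₂² ≤ (1 + (k-1)μ)‖Δ‖₂²`, i.e. the SRIP constant `δ_k`
satisfies `δ_k ≤ (k-1)μ`. -/
theorem srip_le_coherence {N M : ℕ} (D : Matrix (Fin N) (Fin M) ℝ) (μ : ℝ) (k : ℕ)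
    (hμ : 0 ≤ μ)
    (hnorm : ∀ j, (∑ x, D x j ^ 2) = 1)
    (hcoh : ∀ i j, i ≠ j → |∑ x, D x i * D x j| ≤ μ)
    (T : Finset (Fin M))
    (hstripe : ∀ j ∈ T,
      Nat.card {t : Fin M // t ∈ T ∧ t ≠ j ∧ (∑ x, D x t * D x j) ≠ 0} < k)
    (Δ : Fin M → ℝ) (hΔ : ∀ i, Δ i ≠ 0 → i ∈ T) :
    (1 - ((k : ℝ) - 1) * μ) * (∑ i, Δ i ^ 2) ≤ (∑ x, (D.mulVec Δ x) ^ 2) ∧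
      (∑ x, (D.mulVec Δ x) ^ 2) ≤ (1 + ((k : ℝ) - 1) * μ) * (∑ i, Δ i ^ 2) := by
  classical
  set G : Fin M → Fin M → ℝ := fun i j => ∑ x, D x i * D x j with hG
  have hGsymm (i j : Fin M) : G i j = G j i :=
    Finset.sum_congr rfl fun x _ => mul_comm _ _
  have hGdiag (i : Fin M) : G i i = 1 := by
    simpa only [hG, sq] using hnorm i
  set c : Fin M → Fin M → ℝ :=
    fun i j => if i ∈ T ∧ j ∈ T ∧ j ≠ i ∧ G j i ≠ 0 then μ else 0 with hc
  have hcsymm (i j : Fin M) : c i j = c j i := by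
    simp only [hc, hGsymm j i]
    exact if_congr (by rw [ne_comm]; tauto) rfl rfl
  have hcnonneg (i j : Fin M) : 0 ≤ c i j := by
    simp only [hc]
    split_ifs <;> simp [hμ]
  have hrow (i : Fin M) (hi : Δ i ≠ 0) : ∑ j, c i j ≤ ((k : ℝ) - 1) * μ := by
    have hcard := hstripe i (hΔ i hi)
    rw [Nat.card_eq_fintype_card, Fintype.card_subtype] at hcard
    have hsum : ∑ j, c i j =
        ((Finset.univ.filter fun t => t ∈ T ∧ t ≠ i ∧ G t i ≠ 0).card : ℝ) * μ := by
      simp [hc, hΔ i hi, ← Finset.sum_filter]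
    rw [hsum]
    refine mul_le_mul_of_nonneg_right ?_ hμ
    rw [le_sub_iff_add_le]
    exact_mod_cast hcard
  have hA (i j : Fin M) :
      |Δ i * Δ j * (if i = j then 0 else G i j)| ≤ |Δ i * Δ j| * c i j := by
    rw [abs_mul]
    by_cases hz : Δ i * Δ j = 0
    · simp [hz]
    refine mul_le_mul_of_nonneg_left ?_ (abs_nonneg _)
    by_cases hij : i = j
    · simpa [hij] using hcnonneg j j
    by_cases hg : G i j = 0
    · simpa [hg] using hcnonneg i j
    have hcμ : c i j = μ :=
      if_pos ⟨hΔ i (left_ne_zero_of_mul hz), hΔ j (right_ne_zero_of_mul hz), Ne.symm hij,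
        hGsymm i j ▸ hg⟩
    rw [hcμ, if_neg hij]
    exact hcoh i j hij
  have hbound := abs_quadratic_form_le_of_row_sum_le _ c Δ _ hcsymm hA hcnonneg hrow
  have hsplit : ∑ x, (D.mulVec Δ x) ^ 2 =
      ∑ i, Δ i ^ 2 + ∑ i, ∑ j, Δ i * Δ j * (if i = j then 0 else G i j) := by
    rw [sum_sq_mulVec_eq_gram, ← Finset.sum_add_distrib]
    refine Finset.sum_congr rfl fun i _ => ?_
    have hdiag : Δ i ^ 2 = ∑ j, if i = j then Δ i * Δ j else 0 := by simp [sq]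
    rw [hdiag, ← Finset.sum_add_distrib]
    refine Finset.sum_congr rfl fun j _ => ?_
    by_cases hij : i = j
    · subst hij
      simp only [if_true, mul_zero, add_zero]
      exact (congrArg (Δ i * Δ i * ·) (hGdiag i)).trans (mul_one _)
    · simp [hij, hG]
  rw [abs_le] at hbound
  rw [hsplit]
  constructor <;> linarith [hbound.1, hbound.2]
end

section
/- (Stability of the solution to the P_{0,∞}^ε problem, coherence form.) Let D be a real N×M matrix with normalized columns (‖d_j‖₂ = 1) and mutual coherence bound μ (|⟨d_i,d_j⟩| ≤ μ for i ≠ j), and assume (2k−1)μ < 1. Let Γ, Γ̂ ∈ ℝ^M satisfy ‖Y − DΓ‖₂ ≤ ε and ‖Y − DΓ̂‖₂ ≤ ε, and suppose the set S = supp(Γ) ∪ supp(Γ̂) satisfies: for every j ∈ S the number of t ∈ S with t ≠ j and ⟨d_t,d_j⟩ ≠ 0 is at most 2k − 1. Then ‖Γ − Γ̂‖₂² ≤ 4ε²/(1 − (2k−1)μ). -/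
open Classical in
/-- Gershgorin-type lower bound for a symmetric quadratic form with unit diagonal, off-diagonal
entries bounded by `μ`, and at most `n` nonzero off-diagonal entries in each row of the principal
submatrix on `S`, evaluated at a vector supported in `S`. -/
theorem mul_sum_sq_le_quadratic_form {ι : Type*} [Fintype ι] (G : ι → ι → ℝ) (S : ι → Prop)
    (μ n : ℝ) (hμ : 0 ≤ μ) (hsymm : ∀ i j, G i j = G j i) (hdiag : ∀ i, G i i = 1)
    (hoff : ∀ i j, i ≠ j → |G i j| ≤ μ) (v : ι → ℝ) (hv : ∀ i, v i ≠ 0 → S i)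
    (hcard : ∀ j, S j → (Nat.card {t : ι // S t ∧ t ≠ j ∧ G t j ≠ 0} : ℝ) ≤ n) :
    (1 - n * μ) * ∑ i, v i ^ 2 ≤ ∑ i, ∑ j, v i * v j * G i j := by
  let c : ι → ι → ℝ := fun i j => if S i ∧ S j ∧ i ≠ j ∧ G i j ≠ 0 then 1 else 0
  have hc_symm : ∀ i j, c i j = c j i := by
    intro i j
    simp only [c]
    congr 1
    rw [hsymm i j]
    exact propext ⟨fun ⟨a, b, h, g⟩ => ⟨b, a, h.symm, g⟩, fun ⟨a, b, h, g⟩ => ⟨b, a, h.symm, g⟩⟩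
  have hterm : ∀ i j, (if i = j then v i ^ 2 else 0)
      - μ / 2 * (c i j * v i ^ 2) - μ / 2 * (c i j * v j ^ 2) ≤ v i * v j * G i j := by
    intro i j
    by_cases hij : i = j
    · subst hij
      simp [c, hdiag, sq]
    · by_cases hc : S i ∧ S j ∧ i ≠ j ∧ G i j ≠ 0
      · simp only [c, if_pos hc, if_neg hij]
        obtain ⟨h1, h2⟩ := abs_le.mp (hoff i j hij)
        nlinarith [mul_nonneg (sub_nonneg.2 h2) (sq_nonneg (v i - v j)),
          mul_nonneg (neg_le_iff_add_nonneg.1 h1) (sq_nonneg (v i + v j))]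
      · have h0 : v i * v j * G i j = 0 := by
          by_contra h
          have hG := right_ne_zero_of_mul h
          have hvv := left_ne_zero_of_mul h
          exact hc ⟨hv i (left_ne_zero_of_mul hvv), hv j (right_ne_zero_of_mul hvv), hij, hG⟩
        simp [c, if_neg hc, if_neg hij, h0]
  have hrow : ∀ j, (∑ i, c i j) * v j ^ 2 ≤ n * v j ^ 2 := by
    intro j
    by_cases hj : v j = 0
    · simp [hj]
    · have hSj := hv j hj
      refine mul_le_mul_of_nonneg_right (le_trans (le_of_eq ?_) (hcard j hSj)) (sq_nonneg _)
      simp [c, hSj, Finset.sum_boole, Nat.card_eq_fintype_card, Fintype.card_subtype]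
  have hsum : ∑ i, ∑ j, c i j * v j ^ 2 ≤ n * ∑ j, v j ^ 2 := by
    rw [Finset.sum_comm, Finset.mul_sum]
    refine Finset.sum_le_sum fun j _ => ?_
    rw [← Finset.sum_mul]
    exact hrow j
  have hswap : ∑ i, ∑ j, c i j * v i ^ 2 = ∑ i, ∑ j, c i j * v j ^ 2 := by
    rw [Finset.sum_comm]
    simp only [hc_symm]
  have htotal := Finset.sum_le_sum fun i (_ : i ∈ Finset.univ) =>
    Finset.sum_le_sum fun j (_ : j ∈ Finset.univ) => hterm i j
  simp only [Finset.sum_sub_distrib, ← Finset.mul_sum, hswap, Finset.sum_ite_eq,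
    Finset.mem_univ, if_true] at htotal
  nlinarith [mul_le_mul_of_nonneg_left hsum hμ]

/-- The squared norm of `D v` as the quadratic form of the Gram matrix. -/
theorem sum_mulVec_sq_eq_gram {m ι : Type*} [Fintype m] [Fintype ι] (D : Matrix m ι ℝ)
    (v : ι → ℝ) :
    ∑ x, D.mulVec v x ^ 2 = ∑ i, ∑ j, v i * v j * ∑ x, D x i * D x j := by
  simp only [Matrix.mulVec, dotProduct, sq, Finset.sum_mul_sum]
  simp only [Finset.mul_sum]
  rw [Finset.sum_comm]
  refine Finset.sum_congr rfl fun i _ => ?_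
  rw [Finset.sum_comm]
  exact Finset.sum_congr rfl fun j _ => Finset.sum_congr rfl fun x _ => by ring

/-- Stability of the solution to the `P_{0,∞}^ε` problem, coherence form: if both `Γ` and `Γ̂`
explain `Y` up to error `ε`, `(2k-1)μ < 1`, and the union of their supports has stripe overlap
bound `2k`, then `‖Γ - Γ̂‖₂² ≤ 4ε²/(1-(2k-1)μ)`. -/
theorem p0inf_stability_coherence {N M : ℕ} (D : Matrix (Fin N) (Fin M) ℝ)
    (μ ε : ℝ) (k : ℕ) (hμ : 0 ≤ μ) (hε : 0 ≤ ε)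
    (hnorm : ∀ j, (∑ x, D x j ^ 2) = 1)
    (hcoh : ∀ i j, i ≠ j → |∑ x, D x i * D x j| ≤ μ)
    (hk : (2 * (k : ℝ) - 1) * μ < 1)
    (Y : Fin N → ℝ) (Γ Γh : Fin M → ℝ)
    (hΓ : (∑ x, (Y x - D.mulVec Γ x) ^ 2) ≤ ε ^ 2)
    (hΓh : (∑ x, (Y x - D.mulVec Γh x) ^ 2) ≤ ε ^ 2)
    (hS : ∀ j, (Γ j ≠ 0 ∨ Γh j ≠ 0) →
      Nat.card {t : Fin M // (Γ t ≠ 0 ∨ Γh t ≠ 0) ∧ t ≠ j ∧ (∑ x, D x t * D x j) ≠ 0}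
        < 2 * k) :
    (∑ i, (Γ i - Γh i) ^ 2) ≤ 4 * ε ^ 2 / (1 - (2 * (k : ℝ) - 1) * μ) := by
  have hgram := mul_sum_sq_le_quadratic_form (fun i j => ∑ x, D x i * D x j)
    (fun i => Γ i ≠ 0 ∨ Γh i ≠ 0) μ (2 * (k : ℝ) - 1) hμ
    (fun i j => Finset.sum_congr rfl fun x _ => mul_comm _ _)
    (fun i => by simpa only [sq] using hnorm i) hcoh (Γ - Γh)
    (fun i hi => by
      by_contra! h
      exact hi (by simp [h.1, h.2]))
    (fun j hj => by
      rw [le_sub_iff_add_le]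
      exact_mod_cast hS j hj)
  rw [← sum_mulVec_sq_eq_gram] at hgram
  have hres : ∑ x, D.mulVec (Γ - Γh) x ^ 2
      ≤ 2 * ∑ x, (Y x - D.mulVec Γ x) ^ 2 + 2 * ∑ x, (Y x - D.mulVec Γh x) ^ 2 := by
    rw [Finset.mul_sum, Finset.mul_sum, ← Finset.sum_add_distrib]
    refine Finset.sum_le_sum fun x _ => ?_
    rw [Matrix.mulVec_sub, Pi.sub_apply]
    nlinarith [sq_nonneg ((Y x - D.mulVec Γ x) + (Y x - D.mulVec Γh x))]
  simp only [Pi.sub_apply] at hgram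
  rw [le_div_iff₀ (by linarith)]
  linarith
end

section
/- Let D be a real N×M matrix with normalized columns d_1,…,d_M (‖d_j‖₂ = 1) and mutual coherence bound μ (|⟨d_i,d_j⟩| ≤ μ for i ≠ j). Let T ⊆ {1,…,M} be finite and nonempty, Γ ∈ ℝ^M with supp(Γ) ⊆ T, E ∈ ℝ^N, and Y = Σ_{t∈T} Γ_t d_t + E. Let i ∈ T attain the maximum of |Γ_t| over t ∈ T, suppose the number of t ∈ T with t ≠ i and ⟨d_t,d_i⟩ ≠ 0 is at most k − 1, and |⟨d_i, E⟩| ≤ ε_L. Then |⟨d_i, Y⟩| ≥ |Γ_i|·(1 − (k−1)μ) − ε_L. -/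
/-- If all off-diagonal correlations with atom `i` are at most `μ` and coefficients are at most `c`
in absolute value, the off-diagonal interference is at most `μ * c` times the number of overlapping
atoms. -/
theorem abs_sum_erase_mul_le {ι : Type*} [DecidableEq ι] (s S : Finset ι) (i : ι)
    (a g : ι → ℝ) (c μ : ℝ)
    (hS : S ⊆ s.erase i) (hzero : ∀ t ∈ s.erase i, t ∉ S → a t * g t = 0)
    (ha : ∀ t ∈ S, |a t| ≤ c) (hg : ∀ t ∈ S, |g t| ≤ μ) :
    |∑ t ∈ s.erase i, a t * g t| ≤ S.card * (c * μ) := by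
  rw [← Finset.sum_subset hS hzero, ← nsmul_eq_mul]
  refine (Finset.abs_sum_le_sum_abs _ _).trans (Finset.sum_le_card_nsmul _ _ _ fun t ht => ?_)
  rw [abs_mul]
  have := (abs_nonneg (a t)).trans (ha t ht)
  exact mul_le_mul (ha t ht) (hg t ht) (abs_nonneg _) this


/-- Lower bound on the correlation of the maximal-coefficient atom with the noisy signal:
if `i ∈ T` attains `max_{t∈T}|Γ_t|`, then `|⟨d_i, Y⟩| ≥ |Γ_i|·(1 - (k-1)μ) - ε_L`. -/
theorem max_atom_correlation_lower_bound {N M : ℕ} (D : Matrix (Fin N) (Fin M) ℝ)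
    (μ εL : ℝ) (k : ℕ) (hμ : 0 ≤ μ)
    (hnorm : ∀ j, (∑ x, D x j ^ 2) = 1)
    (hcoh : ∀ i j, i ≠ j → |∑ x, D x i * D x j| ≤ μ)
    (T : Finset (Fin M))
    (Γ : Fin M → ℝ) (hsupp : ∀ i, Γ i ≠ 0 → i ∈ T)
    (E Y : Fin N → ℝ) (hY : ∀ x, Y x = D.mulVec Γ x + E x)
    (i : Fin M) (hi : i ∈ T) (hmax : ∀ t ∈ T, |Γ t| ≤ |Γ i|)
    (hoverlap : Nat.card {t : Fin M // t ∈ T ∧ t ≠ i ∧ (∑ x, D x t * D x i) ≠ 0} < k)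
    (hE : |∑ x, D x i * E x| ≤ εL) :
    |Γ i| * (1 - ((k : ℝ) - 1) * μ) - εL ≤ |∑ x, D x i * Y x| := by
  classical
  set G : Fin M → ℝ := fun t => ∑ x, D x t * D x i with hG
  have hY_corr : ∑ x, D x i * Y x = ∑ t, Γ t * G t + ∑ x, D x i * E x := by
    simp only [hY, mul_add, Finset.sum_add_distrib, Matrix.mulVec, dotProduct, hG,
      Finset.mul_sum]
    rw [Finset.sum_comm]
    congr 1
    exact Finset.sum_congr rfl fun t _ => Finset.sum_congr rfl fun x _ => by ring
  have hGi : G i = 1 := by simpa only [hG, sq] using hnorm i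
  have hsplit : ∑ t, Γ t * G t = Γ i + ∑ t ∈ Finset.univ.erase i, Γ t * G t := by
    rw [← Finset.add_sum_erase _ _ (Finset.mem_univ i), hGi, mul_one]
  set S : Finset (Fin M) := Finset.univ.filter fun t => t ∈ T ∧ t ≠ i ∧ G t ≠ 0 with hS
  have hcard : S.card < k := by
    rwa [Nat.card_eq_fintype_card, Fintype.card_subtype] at hoverlap
  have hinterf : |∑ t ∈ Finset.univ.erase i, Γ t * G t| ≤ S.card * (|Γ i| * μ) := by
    refine abs_sum_erase_mul_le _ S i Γ G _ μ ?_ ?_ ?_ ?_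
    · intro t ht
      simp only [hS, Finset.mem_filter] at ht
      simp [ht.2.2.1]
    · intro t ht htS
      by_contra h
      have h' := mul_ne_zero_iff.mp h
      exact htS (Finset.mem_filter.mpr
        ⟨Finset.mem_univ t, hsupp t h'.1, Finset.ne_of_mem_erase ht, h'.2⟩)
    · exact fun t ht => hmax t (Finset.mem_filter.mp ht).2.1
    · exact fun t ht => hcoh t i (Finset.mem_filter.mp ht).2.2.1
  have hcard' : (S.card : ℝ) ≤ k - 1 := by
    have : (S.card : ℝ) + 1 ≤ k := by exact_mod_cast hcard
    linarith
  have hbound := mul_le_mul_of_nonneg_right hcard' (mul_nonneg (abs_nonneg (Γ i)) hμ)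
  set R := ∑ t ∈ Finset.univ.erase i, Γ t * G t
  set e := ∑ x, D x i * E x
  have htri : |Γ i| ≤ |Γ i + R + e| + |R| + |e| := by
    calc |Γ i| = |(Γ i + R + e) - R - e| := by ring_nf
      _ ≤ |(Γ i + R + e) - R| + |e| := abs_sub _ _
      _ ≤ |Γ i + R + e| + |R| + |e| := by gcongr; exact abs_sub _ _
  rw [hY_corr, hsplit]
  linarith
end

section
/- (Success of the first step of OMP in the presence of noise.) Let D be a real N×M matrix with normalized columns d_1,…,d_M (‖d_j‖₂ = 1) and mutual coherence bound μ > 0 (|⟨d_i,d_j⟩| ≤ μ for i ≠ j). Let Γ ∈ ℝ^M have nonempty support T, let E ∈ ℝ^N with |⟨d_j,E⟩| ≤ ε_L for every j ∈ {1,…,M}, and set Y = DΓ + E. Assume T has stripe overlap bound k: for every j ∈ T the number of t ∈ T with t ≠ j and ⟨d_t,d_j⟩ ≠ 0 is at most k − 1, and for every j ∉ T the number of t ∈ T with ⟨d_t,d_j⟩ ≠ 0 is at most k. If k < (1/2)(1 + 1/μ) − (1/μ)·ε_L/max_{t∈T}|Γ_t|, then max_{t∈T} |⟨d_t, Y⟩|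 > max_{j∉T} |⟨d_j, Y⟩|, i.e. the atom with maximal correlation to Y belongs to the true support. -/
/-- The inner product of an atom with a synthesized vector, expanded over the support. -/
lemma sum_mul_mulVec_add {ι κ : Type*} [Fintype ι] [Fintype κ] (D : Matrix ι κ ℝ) (Γ : κ → ℝ)
    (T : Finset κ) (hT : ∀ i ∉ T, Γ i = 0) (E : ι → ℝ) (j : κ) :
    ∑ x, D x j * (D.mulVec Γ x + E x) =
      ∑ t ∈ T, Γ t * (∑ x, D x t * D x j) + ∑ x, D x j * E x := by
  have hsub : ∑ t ∈ T, Γ t * (∑ x, D x t * D x j) = ∑ t, Γ t * (∑ x, D x t * D x j) :=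
    Finset.sum_subset (Finset.subset_univ T) fun t _ ht => by rw [hT t ht, zero_mul]
  rw [hsub]
  simp only [mul_add, Finset.sum_add_distrib, Matrix.mulVec, dotProduct, Finset.mul_sum]
  rw [Finset.sum_comm]
  congr 1
  refine Finset.sum_congr rfl fun t _ => Finset.sum_congr rfl fun x _ => ?_
  ring

/-- A finite sum of terms bounded by `G * μ`, with at most `c` nonzero Gram factors. -/
lemma abs_sum_mul_le_of_card_le {κ : Type*} (S : Finset κ) (Γ g : κ → ℝ) {G μ c : ℝ}
    (hG : 0 ≤ G) (hμ : 0 ≤ μ) (hΓ : ∀ t ∈ S, |Γ t| ≤ G) (hg : ∀ t ∈ S, |g t| ≤ μ)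
    (hc : (Nat.card {t : κ // t ∈ S ∧ g t ≠ 0} : ℝ) ≤ c) :
    |∑ t ∈ S, Γ t * g t| ≤ c * (G * μ) := by
  classical
  have hcard : Nat.card {t : κ // t ∈ S ∧ g t ≠ 0} = (S.filter fun t => g t ≠ 0).card :=
    Nat.subtype_card _ fun t => by simp
  have hfilter : ∑ t ∈ S with g t ≠ 0, Γ t * g t = ∑ t ∈ S, Γ t * g t :=
    Finset.sum_filter_of_ne fun t _ h => right_ne_zero_of_mul h
  rw [hcard] at hc
  rw [← hfilter]
  calc |∑ t ∈ S with g t ≠ 0, Γ t * g t|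
      ≤ ∑ t ∈ S with g t ≠ 0, |Γ t * g t| := Finset.abs_sum_le_sum_abs _ _
    _ ≤ (S.filter fun t => g t ≠ 0).card • (G * μ) := by
        refine Finset.sum_le_card_nsmul _ _ _ fun t ht => ?_
        have htS := (Finset.mem_filter.mp ht).1
        rw [abs_mul]
        exact mul_le_mul (hΓ t htS) (hg t htS) (abs_nonneg _) hG
    _ ≤ c * (G * μ) := by
        rw [nsmul_eq_mul]
        exact mul_le_mul_of_nonneg_right hc (mul_nonneg hG hμ)

/-- Success of the first step of OMP in the presence of noise: under the stripe overlap bound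
and the condition `k < (1/2)(1 + 1/μ) - (1/μ)·ε_L/max_{t∈T}|Γ_t|`, every off-support atom has
strictly smaller correlation with `Y` than the maximal correlation over the true support. -/
theorem omp_first_step_success {N M : ℕ} (D : Matrix (Fin N) (Fin M) ℝ)
    (μ εL : ℝ) (k : ℕ) (hμ : 0 < μ)
    (hnorm : ∀ j, (∑ x, D x j ^ 2) = 1)
    (hcoh : ∀ i j, i ≠ j → |∑ x, D x i * D x j| ≤ μ)
    (Γ : Fin M → ℝ) (T : Finset (Fin M)) (hT : ∀ i, Γ i ≠ 0 ↔ i ∈ T)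
    (hTne : T.Nonempty)
    (E Y : Fin N → ℝ)
    (hE : ∀ j, |∑ x, D x j * E x| ≤ εL)
    (hY : ∀ x, Y x = D.mulVec Γ x + E x)
    (hin : ∀ j ∈ T,
      Nat.card {t : Fin M // t ∈ T ∧ t ≠ j ∧ (∑ x, D x t * D x j) ≠ 0} < k)
    (hout : ∀ j ∉ T,
      Nat.card {t : Fin M // t ∈ T ∧ (∑ x, D x t * D x j) ≠ 0} ≤ k)
    (hk : (k : ℝ) <
      (1 / 2) * (1 + 1 / μ) - (1 / μ) * (εL / (T.sup' hTne fun t => |Γ t|))) :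
    ∀ j ∉ T, |∑ x, D x j * Y x| < T.sup' hTne fun t => |∑ x, D x t * Y x| := by
  intro j hj
  obtain ⟨s, hs, hsG⟩ := T.exists_mem_eq_sup' hTne fun t => |Γ t|
  have hle : ∀ t ∈ T, |Γ t| ≤ |Γ s| := fun t ht =>
    (T.le_sup' (fun t => |Γ t|) ht).trans hsG.le
  have hpos : 0 < |Γ s| := abs_pos.mpr ((hT s).mpr hs)
  have hΓ0 : ∀ i ∉ T, Γ i = 0 := fun i hi => not_not.mp (mt (hT i).mp hi)
  refine lt_of_lt_of_le ?_ (T.le_sup' (fun t => |∑ x, D x t * Y x|) hs)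
  simp only [hY, sum_mul_mulVec_add D Γ T hΓ0 E]
  have hoff : |∑ t ∈ T, Γ t * (∑ x, D x t * D x j)| ≤ (k : ℝ) * (|Γ s| * μ) :=
    abs_sum_mul_le_of_card_le T Γ _ hpos.le hμ.le hle
      (fun t ht => hcoh t j (ne_of_mem_of_not_mem ht hj)) (by exact_mod_cast hout j hj)
  have hon : |∑ t ∈ T.erase s, Γ t * (∑ x, D x t * D x s)| ≤ ((k : ℝ) - 1) * (|Γ s| * μ) := by
    refine abs_sum_mul_le_of_card_le _ Γ _ hpos.le hμ.le
      (fun t ht => hle t (Finset.mem_of_mem_erase ht))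
      (fun t ht => hcoh t s (Finset.ne_of_mem_erase ht)) ?_
    have hcard := hin s hs
    rw [← Nat.card_congr (Equiv.subtypeEquivRight fun t =>
      show (t ∈ T.erase s ∧ (∑ x, D x t * D x s) ≠ 0) ↔ _ by
        rw [Finset.mem_erase, and_comm (a := t ≠ s), and_assoc])] at hcard
    rw [le_sub_iff_add_le]
    exact_mod_cast Nat.succ_le_of_lt hcard
  have hself : ∑ x, D x s * D x s = 1 := by
    simpa only [sq] using hnorm s
  rw [← Finset.add_sum_erase T (fun t => Γ t * (∑ x, D x t * D x s)) hs, hself, mul_one]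
  have hcond : 2 * (k * (|Γ s| * μ)) < |Γ s| * μ + |Γ s| - 2 * εL := by
    rw [hsG] at hk
    have hmul := mul_lt_mul_of_pos_right hk (show 0 < 2 * (|Γ s| * μ) by positivity)
    have hrhs : (1 / 2 * (1 + 1 / μ) - 1 / μ * (εL / |Γ s|)) * (2 * (|Γ s| * μ)) =
        |Γ s| * μ + |Γ s| - 2 * εL := by
      field_simp
    linarith
  have hlower : |Γ s| - ((k : ℝ) - 1) * (|Γ s| * μ) - εL ≤
      |Γ s + ∑ t ∈ T.erase s, Γ t * (∑ x, D x t * D x s) + ∑ x, D x s * E x| := by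
    have h₁ := abs_sub_abs_le_abs_add (Γ s + ∑ t ∈ T.erase s, Γ t * (∑ x, D x t * D x s))
      (∑ x, D x s * E x)
    have h₂ := abs_sub_abs_le_abs_add (Γ s) (∑ t ∈ T.erase s, Γ t * (∑ x, D x t * D x s))
    linarith [hE s]
  have hupper := abs_add_le (∑ t ∈ T, Γ t * (∑ x, D x t * D x j)) (∑ x, D x j * E x)
  linarith [hE j]
end

section
/- (Error bound of the OMP least-squares step, Theorem 3 part b.) Let D be a real N×M matrix with normalized columns (‖d_j‖₂ = 1) and mutual coherence bound μ (|⟨d_i,d_j⟩| ≤ μ for i ≠ j). Let T ⊆ {1,…,M} satisfy: for every j ∈ T the number of t ∈ T with t ≠ j and ⟨d_t,d_j⟩ ≠ 0 is at most k − 1, with (k−1)μ < 1. Let Γ_T ∈ ℝ^T, E ∈ ℝ^N with ‖E‖₂ ≤ ε, and Y = D_T Γ_T + E. Then the Gram matrix G_T = D_T^T D_T is invertible, and the least-squares solution Γ_LS = G_T^{-1} D_T^T Y satisfies ‖Γ_LS − Γ_T‖₂² ≤ ε² / (1 − (k−1)μ). -/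
open Matrix in
/-- Quadratic-form version of Gershgorin's bound: a symmetric real matrix with unit diagonal and
off-diagonal entries bounded by `μ`, at most `r` of which are nonzero in each column, is bounded
below by `1 - r μ`. -/
theorem Matrix.one_sub_mul_dotProduct_le_of_sparse {ι : Type*} [Fintype ι] [DecidableEq ι]
    {G : Matrix ι ι ℝ} {μ r : ℝ} (hμ : 0 ≤ μ) (hsymm : G.IsSymm) (hdiag : ∀ i, G i i = 1)
    (hoff : ∀ i j, i ≠ j → |G i j| ≤ μ)
    (hcard : ∀ j, ((Finset.univ.filter fun i => i ≠ j ∧ G i j ≠ 0).card : ℝ) ≤ r) (z : ι → ℝ) :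
    (1 - r * μ) * (z ⬝ᵥ z) ≤ z ⬝ᵥ G *ᵥ z := by
  set w : ι → ι → ℝ := fun i j => if i ≠ j ∧ G i j ≠ 0 then μ else 0 with hw
  have hw_symm : ∀ i j, w i j = w j i := fun i j => by
    simp only [hw, hsymm.apply i j, ne_comm (a := i)]
  have hw_sum : ∀ j, ∑ i, w i j ≤ r * μ := fun j => by
    simp only [hw, ← Finset.sum_filter, Finset.sum_const, nsmul_eq_mul]
    exact mul_le_mul_of_nonneg_right (hcard j) hμ
  have hentry : ∀ i j, (if i = j then z i * z j else 0) - w i j * (z i ^ 2 + z j ^ 2) / 2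
      ≤ z i * (G i j * z j) := fun i j => by
    by_cases hij : i = j
    · subst hij
      simp [hw, hdiag]
    by_cases hG : G i j = 0
    · simp [hw, hij, hG]
    · have h := abs_le.mp (hoff i j hij)
      simp only [hw, hij, hG, ne_eq, not_false_eq_true, and_self, if_true, if_false]
      nlinarith [mul_nonneg (sub_nonneg.2 h.2) (sq_nonneg (z i - z j)),
        mul_nonneg (neg_le_iff_add_nonneg.1 h.1) (sq_nonneg (z i + z j))]
  have hweight : ∑ j, ∑ i, w i j * z j ^ 2 ≤ r * μ * (z ⬝ᵥ z) := by
    simp only [dotProduct, Finset.mul_sum, ← Finset.sum_mul]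
    refine Finset.sum_le_sum fun j _ => ?_
    rw [← sq]
    exact mul_le_mul_of_nonneg_right (hw_sum j) (sq_nonneg _)
  have hweight_swap : ∑ j, ∑ i, w i j * z i ^ 2 = ∑ j, ∑ i, w i j * z j ^ 2 := by
    rw [Finset.sum_comm]
    exact Finset.sum_congr rfl fun i _ => Finset.sum_congr rfl fun j _ => by rw [hw_symm]
  calc (1 - r * μ) * (z ⬝ᵥ z)
      ≤ z ⬝ᵥ z - (∑ j, ∑ i, w i j * z i ^ 2 + ∑ j, ∑ i, w i j * z j ^ 2) / 2 := by
        linarith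
    _ = ∑ j, ∑ i, ((if i = j then z i * z j else 0) - w i j * (z i ^ 2 + z j ^ 2) / 2) := by
        simp only [Finset.sum_sub_distrib, mul_add, add_div, Finset.sum_add_distrib,
          ← Finset.sum_div, Finset.sum_ite_eq', Finset.mem_univ, if_true, dotProduct]
    _ ≤ ∑ j, ∑ i, z i * (G i j * z j) :=
        Finset.sum_le_sum fun j _ => Finset.sum_le_sum fun i _ => hentry i j
    _ = z ⬝ᵥ G *ᵥ z := by
        rw [Finset.sum_comm]
        simp only [dotProduct, mulVec, Finset.mul_sum]

open Matrix in
/-- If the Gram matrix `AᵀA` is bounded below by `c > 0`, it is invertible and the least-squares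
solution for the noisy observation `A x + e` has squared error at most `‖e‖² / c`. -/
theorem Matrix.isUnit_gram_and_leastSquares_error_le {m ι : Type*} [Fintype m] [Fintype ι]
    [DecidableEq ι] (A : Matrix m ι ℝ) {c : ℝ} (hc : 0 < c)
    (hA : ∀ z : ι → ℝ, c * (z ⬝ᵥ z) ≤ z ⬝ᵥ (Aᵀ * A) *ᵥ z) (x : ι → ℝ) (e : m → ℝ) :
    IsUnit (Aᵀ * A) ∧
      ((Aᵀ * A)⁻¹ *ᵥ (Aᵀ *ᵥ (A *ᵥ x + e)) - x) ⬝ᵥ ((Aᵀ * A)⁻¹ *ᵥ (Aᵀ *ᵥ (A *ᵥ x + e)) - x)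
        ≤ (e ⬝ᵥ e) / c := by
  have hunit : IsUnit (Aᵀ * A) := by
    refine mulVec_injective_iff_isUnit.1 fun u v huv => ?_
    have h := hA (u - v)
    rw [mulVec_sub, huv, sub_self, dotProduct_zero] at h
    have hnonneg : 0 ≤ (u - v) ⬝ᵥ (u - v) := Finset.sum_nonneg fun i _ => mul_self_nonneg _
    exact sub_eq_zero.1 (dotProduct_self_eq_zero.1 (by nlinarith))
  refine ⟨hunit, ?_⟩
  have hdet := (isUnit_iff_isUnit_det _).1 hunit
  set z := (Aᵀ * A)⁻¹ *ᵥ (Aᵀ *ᵥ (A *ᵥ x + e)) - x with hz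
  have hnormal : (Aᵀ * A) *ᵥ z = Aᵀ *ᵥ e := by
    rw [hz, mulVec_sub, mulVec_mulVec, mul_nonsing_inv _ hdet, one_mulVec, mulVec_add,
      mulVec_mulVec, add_sub_cancel_left]
  have hAz : z ⬝ᵥ (Aᵀ * A) *ᵥ z = A *ᵥ z ⬝ᵥ A *ᵥ z := by
    rw [← mulVec_mulVec, dotProduct_mulVec, vecMul_transpose]
  have hAe : z ⬝ᵥ (Aᵀ * A) *ᵥ z = A *ᵥ z ⬝ᵥ e := by
    rw [hnormal, dotProduct_mulVec, vecMul_transpose]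
  have hsq : 0 ≤ (A *ᵥ z - e) ⬝ᵥ (A *ᵥ z - e) := Finset.sum_nonneg fun i _ => mul_self_nonneg _
  rw [sub_dotProduct, dotProduct_sub, dotProduct_sub, dotProduct_comm e (A *ᵥ z)] at hsq
  rw [le_div_iff₀ hc]
  linarith [hA z]

/-- Error bound of the OMP least-squares step: if the support `T` has stripe overlap bound `k`
with `(k-1)μ < 1` and `Y = D_T Γ_T + E` with `‖E‖₂ ≤ ε`, then the Gram matrix
`G = D_Tᵀ D_T` is invertible and the least-squares solution `Γ_LS = G⁻¹ D_Tᵀ Y` satisfies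
`‖Γ_LS - Γ_T‖₂² ≤ ε²/(1-(k-1)μ)`. -/
theorem omp_least_squares_error {N M : ℕ} (D : Matrix (Fin N) (Fin M) ℝ)
    (μ ε : ℝ) (k : ℕ) (hμ : 0 ≤ μ)
    (hnorm : ∀ j, (∑ x, D x j ^ 2) = 1)
    (hcoh : ∀ i j, i ≠ j → |∑ x, D x i * D x j| ≤ μ)
    (T : Finset (Fin M))
    (hin : ∀ j ∈ T,
      Nat.card {t : Fin M // t ∈ T ∧ t ≠ j ∧ (∑ x, D x t * D x j) ≠ 0} < k)
    (hk : ((k : ℝ) - 1) * μ < 1)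
    (ΓT : {x // x ∈ T} → ℝ) (E Y : Fin N → ℝ)
    (hE : (∑ x, E x ^ 2) ≤ ε ^ 2)
    (hY : ∀ x, Y x = (∑ t : {x // x ∈ T}, ΓT t * D x t.1) + E x)
    (G : Matrix {x // x ∈ T} {x // x ∈ T} ℝ)
    (hG : G = Matrix.of fun t s : {x // x ∈ T} => ∑ x, D x t.1 * D x s.1) :
    IsUnit G ∧
      (∑ t : {x // x ∈ T},
        (G⁻¹.mulVec (fun s : {x // x ∈ T} => ∑ x, D x s.1 * Y x) t - ΓT t) ^ 2)
        ≤ ε ^ 2 / (1 - ((k : ℝ) - 1) * μ) := by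
  set A : Matrix (Fin N) {x // x ∈ T} ℝ := Matrix.of fun x t => D x t.1 with hAdef
  have hGA : G = A.transpose * A := by
    ext t s
    simp [hG, hAdef, Matrix.mul_apply]
  have hcard : ∀ j : {x // x ∈ T},
      ((Finset.univ.filter fun i => i ≠ j ∧ G i j ≠ 0).card : ℝ) ≤ (k : ℝ) - 1 := fun j => by
    have hle : (Finset.univ.filter fun i => i ≠ j ∧ G i j ≠ 0).card ≤
        Nat.card {t : Fin M // t ∈ T ∧ t ≠ j.1 ∧ (∑ x, D x t * D x j.1) ≠ 0} := by
      rw [← Fintype.card_subtype, ← Nat.card_eq_fintype_card]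
      refine Nat.card_le_card_of_injective
        (fun i => ⟨i.1.1, i.1.2, fun h => i.2.1 (Subtype.ext h), by simpa [hG] using i.2.2⟩)
        fun a b hab => Subtype.ext (Subtype.ext (Subtype.mk.inj hab))
    have hlt := hle.trans_lt (hin j.1 j.2)
    have : ((Finset.univ.filter fun i => i ≠ j ∧ G i j ≠ 0).card : ℝ) + 1 ≤ k := by
      exact_mod_cast hlt
    linarith
  have hbound := Matrix.one_sub_mul_dotProduct_le_of_sparse (G := G) hμ
    (by rw [hGA]; simp [Matrix.IsSymm, Matrix.transpose_mul])
    (fun i => by simpa [hG, ← sq] using hnorm i.1)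
    (fun i j hij => by simpa [hG] using hcoh i.1 j.1 fun h => hij (Subtype.ext h)) hcard
  have hc : 0 < 1 - ((k : ℝ) - 1) * μ := sub_pos.2 hk
  obtain ⟨hunit, herr⟩ := Matrix.isUnit_gram_and_leastSquares_error_le A hc
    (by rwa [← hGA]) ΓT E
  have hYA : Y = A.mulVec ΓT + E := by
    ext x
    simp [hY, hAdef, Matrix.mulVec, dotProduct, mul_comm]
  rw [← hGA, ← hYA] at herr
  refine ⟨hGA ▸ hunit, ?_⟩
  calc _ ≤ (E ⬝ᵥ E) / (1 - ((k : ℝ) - 1) * μ) := by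
        simp only [dotProduct, ← sq] at herr ⊢
        exact herr
    _ ≤ _ := by
        gcongr
        simpa only [dotProduct, ← sq] using hE
end

section
/- Let D be a real N×M matrix with normalized columns (‖d_j‖₂ = 1) and mutual coherence bound μ (|⟨d_i,d_j⟩| ≤ μ for i ≠ j). Let T ⊆ {1,…,M} satisfy the stripe overlap bound k: for every j ∈ T the number of t ∈ T with t ≠ j and ⟨d_t,d_j⟩ ≠ 0 is at most k − 1, and assume (k−1)μ < 1. Then the Gram matrix G_T = D_T^T D_T is invertible and ‖G_T^{-1}‖_∞ ≤ 1/(1 − (k−1)μ), where ‖·‖_∞ is the operator norm induced by the ℓ∞ vector norm. In particular, if moreover k < (1/3)(1 + 1/μ) then ‖G_T^{-1}‖_∞ < 3/2. -/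
/-- Ahlberg–Nilson–Varah bound: a diagonal dominance gap of at least `α` in every row bounds the
sup norm of `A *ᵥ v` from below. -/
theorem Matrix.mul_norm_le_norm_mulVec_of_le_diag_sub_sum {ι K : Type*} [Fintype ι] [DecidableEq ι]
    [NormedField K] (A : Matrix ι ι K) {α : ℝ}
    (h : ∀ i, α ≤ ‖A i i‖ - ∑ j ∈ Finset.univ.erase i, ‖A i j‖) (v : ι → K) :
    α * ‖v‖ ≤ ‖A.mulVec v‖ := by
  cases isEmpty_or_nonempty ι
  · simp [Subsingleton.elim v 0]
  obtain ⟨i, hmax⟩ := Finite.exists_max fun i => ‖v i‖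
  have hi : ‖v i‖ = ‖v‖ :=
    (norm_le_pi_norm v i).antisymm ((pi_norm_le_iff_of_nonneg (norm_nonneg _)).mpr hmax)
  have hsum : ‖∑ j ∈ Finset.univ.erase i, A i j * v j‖ ≤
      (∑ j ∈ Finset.univ.erase i, ‖A i j‖) * ‖v‖ := by
    rw [Finset.sum_mul]
    refine norm_sum_le_of_le _ fun j _ => ?_
    rw [norm_mul]
    gcongr
    exact norm_le_pi_norm v j
  have hsplit : A.mulVec v i = A i i * v i + ∑ j ∈ Finset.univ.erase i, A i j * v j :=
    (Finset.add_sum_erase _ _ (Finset.mem_univ i)).symm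
  calc α * ‖v‖ ≤ (‖A i i‖ - ∑ j ∈ Finset.univ.erase i, ‖A i j‖) * ‖v‖ := by
        gcongr
        exact h i
    _ ≤ ‖A i i * v i‖ - ‖∑ j ∈ Finset.univ.erase i, A i j * v j‖ := by
        rw [norm_mul, hi]
        linarith
    _ ≤ ‖A.mulVec v i‖ := by
        rw [hsplit]
        exact norm_sub_le_norm_add _ _
    _ ≤ ‖A.mulVec v‖ := norm_le_pi_norm _ i

/-- A sum of norms of terms bounded by `μ` is at most `μ` times the number of nonzero terms. -/
theorem Finset.sum_norm_le_card_support_mul {ι E : Type*} [NormedAddCommGroup E] [DecidableEq E]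
    (s : Finset ι) (f : ι → E) {μ : ℝ} (h : ∀ i ∈ s, ‖f i‖ ≤ μ) :
    ∑ i ∈ s, ‖f i‖ ≤ (s.filter fun i => f i ≠ 0).card * μ := by
  rw [← Finset.sum_filter_of_ne (p := fun i => f i ≠ 0) fun i _ hi => norm_ne_zero_iff.mp hi,
    ← nsmul_eq_mul]
  exact Finset.sum_le_card_nsmul _ _ _ fun i hi => h i (Finset.mem_filter.mp hi).1

/-- Inverse Gram matrix bound in the convolutional model: if the support `T` has stripe
overlap bound `k` with `(k-1)μ < 1`, then `G = D_Tᵀ D_T` is invertible and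
`‖G⁻¹‖_∞ ≤ 1/(1-(k-1)μ)` (stated via the sup norm of `G⁻¹ x`); moreover if
`k < (1/3)(1 + 1/μ)` then `‖G⁻¹‖_∞ < 3/2`. -/
theorem inverse_gram_linfty_bound {N M : ℕ} (D : Matrix (Fin N) (Fin M) ℝ)
    (μ : ℝ) (k : ℕ) (hμ : 0 ≤ μ)
    (hnorm : ∀ j, (∑ x, D x j ^ 2) = 1)
    (hcoh : ∀ i j, i ≠ j → |∑ x, D x i * D x j| ≤ μ)
    (T : Finset (Fin M))
    (hin : ∀ j ∈ T,
      Nat.card {t : Fin M // t ∈ T ∧ t ≠ j ∧ (∑ x, D x t * D x j) ≠ 0} < k)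
    (hk : ((k : ℝ) - 1) * μ < 1)
    (G : Matrix {x // x ∈ T} {x // x ∈ T} ℝ)
    (hG : G = Matrix.of fun t s : {x // x ∈ T} => ∑ x, D x t.1 * D x s.1) :
    IsUnit G ∧
      (∀ x : {a // a ∈ T} → ℝ, ‖G⁻¹.mulVec x‖ ≤ ‖x‖ / (1 - ((k : ℝ) - 1) * μ)) ∧
      ((k : ℝ) < (1 / 3) * (1 + 1 / μ) →
        ∀ x : {a // a ∈ T} → ℝ, x ≠ 0 → ‖G⁻¹.mulVec x‖ < (3 / 2) * ‖x‖) := by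
  have hpos : 0 < 1 - ((k : ℝ) - 1) * μ := by linarith
  have hrow : ∀ i, 1 - ((k : ℝ) - 1) * μ ≤ ‖G i i‖ - ∑ j ∈ Finset.univ.erase i, ‖G i j‖ := by
    intro i
    have hdiag : G i i = 1 := by
      simpa [hG, sq] using hnorm i
    have hoff : ∀ j ∈ Finset.univ.erase i, ‖G i j‖ ≤ μ := by
      intro j hj
      have hne : (i : Fin M) ≠ j := fun h => (Finset.ne_of_mem_erase hj) (Subtype.ext h.symm)
      simpa [hG] using hcoh i j hne
    have hcard : ((Finset.univ.erase i).filter fun j => G i j ≠ 0).card < k := by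
      refine lt_of_le_of_lt ?_ (hin i i.2)
      rw [← Nat.card_eq_finsetCard]
      refine Nat.card_le_card_of_injective (fun j => ⟨j.1.1, j.1.2, ?_, ?_⟩) ?_
      · exact fun h => Finset.ne_of_mem_erase (Finset.mem_filter.mp j.2).1 (Subtype.ext h)
      · simpa [hG, mul_comm] using (Finset.mem_filter.mp j.2).2
      · exact fun a b hab => Subtype.ext (Subtype.ext (Subtype.mk.inj hab))
    have hcard' : (((Finset.univ.erase i).filter fun j => G i j ≠ 0).card : ℝ) ≤ (k : ℝ) - 1 := by
      have : (((Finset.univ.erase i).filter fun j => G i j ≠ 0).card : ℝ) + 1 ≤ k := by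
        exact_mod_cast hcard
      linarith
    have hsum := Finset.sum_norm_le_card_support_mul _ (G i) hoff
    have := mul_le_mul_of_nonneg_right hcard' hμ
    rw [hdiag, norm_one]
    linarith
  have hlow := G.mul_norm_le_norm_mulVec_of_le_diag_sub_sum hrow
  have hunit : IsUnit G := by
    rw [← Matrix.mulVec_injective_iff_isUnit]
    intro u v huv
    have h := hlow (u - v)
    rw [Matrix.mulVec_sub, huv, sub_self, norm_zero] at h
    exact sub_eq_zero.mp (norm_le_zero_iff.mp (nonpos_of_mul_nonpos_right h hpos))
  have hinv : ∀ x : {a // a ∈ T} → ℝ, ‖G⁻¹.mulVec x‖ ≤ ‖x‖ / (1 - ((k : ℝ) - 1) * μ) := by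
    intro x
    have h := hlow (G⁻¹.mulVec x)
    rw [Matrix.mulVec_mulVec, Matrix.mul_nonsing_inv _ ((Matrix.isUnit_iff_isUnit_det G).mp hunit),
      Matrix.one_mulVec] at h
    rwa [le_div_iff₀' hpos]
  refine ⟨hunit, hinv, fun hk3 x hx => (hinv x).trans_lt ?_⟩
  obtain ⟨j, -⟩ := Function.ne_iff.mp hx
  have hk1 : (1 : ℝ) ≤ k := by exact_mod_cast (Nat.zero_le _).trans_lt (hin j j.2)
  have hμ0 : 0 < μ := by
    refine hμ.lt_of_ne fun h => ?_
    rw [← h] at hk3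
    norm_num at hk3
    linarith
  have hkμ : (k : ℝ) * μ < 1 / 3 * (μ + 1) := by
    have h := mul_lt_mul_of_pos_right hk3 hμ0
    field_simp at h ⊢
    linarith
  rw [div_lt_iff₀ hpos]
  nlinarith [norm_pos_iff.mpr hx]
end

section
/- (Quantitative ERC bound in the convolutional sparse model.) Let D be a real N×M matrix with normalized columns d_1,…,d_M (‖d_j‖₂ = 1) and mutual coherence bound μ (|⟨d_i,d_j⟩| ≤ μ for i ≠ j). Let T ⊆ {1,…,M} satisfy the stripe overlap bound k: for every j ∈ T the number of t ∈ T with t ≠ j and ⟨d_t,d_j⟩ ≠ 0 is at most k − 1, and for every j ∉ T the number of t ∈ T with ⟨d_t,d_j⟩ ≠ 0 is at most k. Assume (k−1)μ < 1. Then the Gram matrix G_T = D_T^T D_T is invertible and for every i ∉ T, ‖G_T^{-1} D_T^T d_i‖₁ ≤ k·μ / (1 − (k−1)μ). -/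
/-- A matrix that is strictly diagonally dominant by columns, with margin `c`, expands the
`ℓ¹` norm by at least the factor `c`. -/
theorem mul_sum_abs_le_sum_abs_mulVec {ι : Type*} [Fintype ι] [DecidableEq ι]
    (A : Matrix ι ι ℝ) (c : ℝ)
    (hA : ∀ s, c + ∑ t ∈ Finset.univ.erase s, |A t s| ≤ |A s s|) (v : ι → ℝ) :
    c * ∑ s, |v s| ≤ ∑ t, |A.mulVec v t| := by
  have hrow : ∀ t, |A t t| * |v t| - ∑ s ∈ Finset.univ.erase t, |A t s| * |v s|
      ≤ |A.mulVec v t| := by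
    intro t
    have hsplit : A.mulVec v t = A t t * v t + ∑ s ∈ Finset.univ.erase t, A t s * v s :=
      (Finset.add_sum_erase _ (fun s => A t s * v s) (Finset.mem_univ t)).symm
    have hoff : |∑ s ∈ Finset.univ.erase t, A t s * v s|
        ≤ ∑ s ∈ Finset.univ.erase t, |A t s| * |v s| := by
      simpa only [abs_mul] using
        Finset.abs_sum_le_sum_abs (fun s => A t s * v s) (Finset.univ.erase t)
    have htri := abs_sub_abs_le_abs_sub (A t t * v t)
      (-∑ s ∈ Finset.univ.erase t, A t s * v s)
    rw [abs_neg, sub_neg_eq_add, ← hsplit, abs_mul] at htri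
    linarith
  have hswap : ∑ t, ∑ s ∈ Finset.univ.erase t, |A t s| * |v s|
      = ∑ s, ∑ t ∈ Finset.univ.erase s, |A t s| * |v s| :=
    Finset.sum_comm' fun t s => by
      simp only [Finset.mem_univ, Finset.mem_erase, and_true, true_and]
      exact ne_comm
  calc c * ∑ s, |v s|
      ≤ ∑ s, (|A s s| * |v s| - ∑ t ∈ Finset.univ.erase s, |A t s| * |v s|) := by
        rw [Finset.mul_sum]
        refine Finset.sum_le_sum fun s _ => ?_
        rw [← Finset.sum_mul, ← sub_mul]
        exact mul_le_mul_of_nonneg_right (by linarith [hA s]) (abs_nonneg _)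
    _ = ∑ t, (|A t t| * |v t| - ∑ s ∈ Finset.univ.erase t, |A t s| * |v s|) := by
        rw [Finset.sum_sub_distrib, Finset.sum_sub_distrib, hswap]
    _ ≤ ∑ t, |A.mulVec v t| := Finset.sum_le_sum fun t _ => hrow t

/-- The `ℓ¹` norm of a family is at most the size of its support times a bound on its entries. -/
theorem sum_abs_le_card_support_mul {ι : Type*} (s : Finset ι) (f : ι → ℝ) (μ : ℝ)
    (hf : ∀ t ∈ s, |f t| ≤ μ) :
    ∑ t ∈ s, |f t| ≤ (Nat.card {t // t ∈ s ∧ f t ≠ 0} : ℝ) * μ := by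
  classical
  have hcard : Nat.card {t // t ∈ s ∧ f t ≠ 0} = (s.filter fun t => f t ≠ 0).card := by
    rw [← Nat.card_eq_finsetCard]
    simp only [Finset.mem_filter]
  rw [hcard, ← nsmul_eq_mul, ← Finset.sum_filter_of_ne (p := fun t => f t ≠ 0)
    fun t _ h => abs_ne_zero.mp h]
  exact Finset.sum_le_card_nsmul _ _ _ fun t ht => hf t (Finset.mem_filter.mp ht).1

/-- Quantitative ERC bound in the convolutional sparse model: under the stripe overlap bounds
and `(k-1)μ < 1`, the Gram matrix `G = D_Tᵀ D_T` is invertible and for every `i ∉ T`,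
`‖G⁻¹ D_Tᵀ d_i‖₁ ≤ kμ/(1-(k-1)μ)`. -/
theorem erc_quantitative_bound {N M : ℕ} (D : Matrix (Fin N) (Fin M) ℝ)
    (μ : ℝ) (k : ℕ) (hμ : 0 ≤ μ)
    (hnorm : ∀ j, (∑ x, D x j ^ 2) = 1)
    (hcoh : ∀ i j, i ≠ j → |∑ x, D x i * D x j| ≤ μ)
    (T : Finset (Fin M))
    (hin : ∀ j ∈ T,
      Nat.card {t : Fin M // t ∈ T ∧ t ≠ j ∧ (∑ x, D x t * D x j) ≠ 0} < k)
    (hout : ∀ j ∉ T,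
      Nat.card {t : Fin M // t ∈ T ∧ (∑ x, D x t * D x j) ≠ 0} ≤ k)
    (hk : ((k : ℝ) - 1) * μ < 1)
    (G : Matrix {x // x ∈ T} {x // x ∈ T} ℝ)
    (hG : G = Matrix.of fun t s : {x // x ∈ T} => ∑ x, D x t.1 * D x s.1) :
    IsUnit G ∧ ∀ i ∉ T,
      (∑ t : {x // x ∈ T},
        |G⁻¹.mulVec (fun s : {x // x ∈ T} => ∑ x, D x s.1 * D x i) t|)
        ≤ (k : ℝ) * μ / (1 - ((k : ℝ) - 1) * μ) := by
  have hcol : ∀ s, (1 - ((k : ℝ) - 1) * μ) + ∑ t ∈ Finset.univ.erase s, |G t s| ≤ |G s s| := by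
    intro s
    have hdiag : G s s = 1 := by
      rw [hG, ← hnorm s.1]
      simp [sq]
    have hsum : ∑ t ∈ Finset.univ.erase s, |G t s|
        = ∑ t ∈ T.erase s.1, |∑ x, D x t * D x s.1| := by
      subst hG
      refine Finset.sum_bij (fun t _ => t.1) ?_ ?_ ?_ ?_
      · intro t ht
        exact Finset.mem_erase.mpr
          ⟨fun h => (Finset.mem_erase.mp ht).1 (Subtype.ext h), t.2⟩
      · exact fun _ _ _ _ h => Subtype.ext h
      · intro t ht
        obtain ⟨hne, hmem⟩ := Finset.mem_erase.mp ht
        exact ⟨⟨t, hmem⟩, Finset.mem_erase.mpr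
          ⟨fun h => hne (congrArg Subtype.val h), Finset.mem_univ _⟩, rfl⟩
      · exact fun _ _ => rfl
    have hbound := sum_abs_le_card_support_mul (T.erase s.1)
      (fun t => ∑ x, D x t * D x s.1) μ fun t ht => hcoh t s.1 (Finset.ne_of_mem_erase ht)
    have hset : Nat.card {t // t ∈ T.erase s.1 ∧ (∑ x, D x t * D x s.1) ≠ 0} < k := by
      convert hin s.1 s.2 using 4
      simp only [Finset.mem_erase]
      tauto
    have hle : (Nat.card {t // t ∈ T.erase s.1 ∧ (∑ x, D x t * D x s.1) ≠ 0} : ℝ)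
        ≤ (k : ℝ) - 1 := by
      rw [le_sub_iff_add_le]
      exact_mod_cast hset
    rw [hsum, hdiag, abs_one]
    linarith [mul_le_mul_of_nonneg_right hle hμ]
  have hc : 0 < 1 - ((k : ℝ) - 1) * μ := by linarith
  have hexp := mul_sum_abs_le_sum_abs_mulVec G _ hcol
  have hunit : IsUnit G := by
    rw [← Matrix.mulVec_injective_iff_isUnit]
    intro v w hvw
    have h := hexp (v - w)
    rw [Matrix.mulVec_sub, sub_eq_zero.mpr hvw] at h
    simp only [Pi.zero_apply, abs_zero, Finset.sum_const_zero] at h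
    have hzero : ∑ s, |(v - w) s| = 0 :=
      le_antisymm (nonpos_of_mul_nonpos_right h hc) (Finset.sum_nonneg fun _ _ => abs_nonneg _)
    rw [Finset.sum_eq_zero_iff_of_nonneg fun _ _ => abs_nonneg _] at hzero
    funext s
    exact sub_eq_zero.mp (abs_eq_zero.mp (hzero s (Finset.mem_univ s)))
  refine ⟨hunit, fun i hi => ?_⟩
  rw [le_div_iff₀' hc]
  refine (hexp _).trans ?_
  rw [Matrix.mulVec_mulVec, Matrix.mul_nonsing_inv _ ((Matrix.isUnit_iff_isUnit_det G).mp hunit),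
    Matrix.one_mulVec, Finset.sum_coe_sort T fun t => |∑ x, D x t * D x i|]
  refine (sum_abs_le_card_support_mul T (fun t => ∑ x, D x t * D x i) μ
    fun t ht => hcoh t i (ne_of_mem_of_not_mem ht hi)).trans ?_
  exact mul_le_mul_of_nonneg_right (by exact_mod_cast hout i hi) hμ
end

section
/- (Theorem: ERC in the convolutional sparse model.) Let D be a real N×M matrix with normalized columns d_1,…,d_M (‖d_j‖₂ = 1) and mutual coherence bound μ > 0 (|⟨d_i,d_j⟩| ≤ μ for i ≠ j). Let T ⊆ {1,…,M} satisfy the stripe overlap bound k: for every j ∈ T the number of t ∈ T with t ≠ j and ⟨d_t,d_j⟩ ≠ 0 is at most k − 1, and for every j ∉ T the number of t ∈ T with ⟨d_t,d_j⟩ ≠ 0 is at most k. If k < (1/2)(1 + 1/μ), then the Gram matrix G_T = D_T^T D_T is invertible and the Exact Recovery Condition holds for T: for every i ∉ T, ‖G_T^{-1} D_T^T d_i‖₁ < 1. -/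
open Finset in
/-- The `ℓ¹` operator norm of a matrix is bounded by its largest absolute column sum. -/
theorem Matrix.sum_abs_mulVec_le {m n : Type*} [Fintype m] [Fintype n] (A : Matrix m n ℝ) {c : ℝ}
    (hA : ∀ s, ∑ t, |A t s| ≤ c) (x : n → ℝ) :
    ∑ t, |A.mulVec x t| ≤ c * ∑ s, |x s| := by
  calc ∑ t, |A.mulVec x t| ≤ ∑ t, ∑ s, |A t s| * |x s| := by
        refine sum_le_sum fun t _ => ?_
        simp only [← abs_mul]
        exact abs_sum_le_sum_abs (fun s => A t s * x s) univ
    _ = ∑ s, (∑ t, |A t s|) * |x s| := by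
        rw [sum_comm]
        simp only [sum_mul]
    _ ≤ ∑ s, c * |x s| :=
        sum_le_sum fun s _ => mul_le_mul_of_nonneg_right (hA s) (abs_nonneg _)
    _ = c * ∑ s, |x s| := (mul_sum ..).symm

open Finset in
/-- If the absolute column sums of `G - 1` are at most `c`, then `G` shrinks `ℓ¹` norms by at most
the factor `1 - c`. -/
theorem Matrix.one_sub_mul_sum_abs_le {n : Type*} [Fintype n] [DecidableEq n] (G : Matrix n n ℝ)
    {c : ℝ} (hG : ∀ s, ∑ t, |(G - 1) t s| ≤ c) (x : n → ℝ) :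
    (1 - c) * ∑ t, |x t| ≤ ∑ t, |G.mulVec x t| := by
  have h := (G - 1).sum_abs_mulVec_le hG x
  have htri : ∑ t, |x t| ≤ ∑ t, |G.mulVec x t| + ∑ t, |(G - 1).mulVec x t| := by
    rw [← sum_add_distrib]
    refine sum_le_sum fun t _ => ?_
    have hx : x t = G.mulVec x t - (G - 1).mulVec x t := by
      simp [Matrix.sub_mulVec]
    calc |x t| = |G.mulVec x t - (G - 1).mulVec x t| := by rw [← hx]
      _ ≤ _ := abs_sub _ _
  linarith

open Finset in
/-- A sum of absolute values over `T` is at most the number of its nonzero terms times a common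
bound for them. -/
theorem Finset.sum_abs_subtype_le_card_mul {α : Type*} (T : Finset α) (p : α → Prop) (f : α → ℝ)
    {μ r : ℝ} (hμ : 0 ≤ μ) (hf : ∀ t ∈ T, f t ≠ 0 → p t ∧ |f t| ≤ μ)
    (hr : (Nat.card {t : α // t ∈ T ∧ p t} : ℝ) ≤ r) :
    ∑ t : {x // x ∈ T}, |f t| ≤ r * μ := by
  classical
  have hcard : Nat.card {t : α // t ∈ T ∧ p t} = #{t ∈ T | p t} :=
    Nat.subtype_card _ (by simp)
  rw [sum_coe_sort T fun t => |f t|]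
  calc ∑ t ∈ T, |f t| ≤ ∑ t ∈ T, if p t then μ else 0 := by
        refine sum_le_sum fun t ht => ?_
        by_cases h0 : f t = 0
        · rw [h0, abs_zero]
          split_ifs <;> simp [hμ]
        · simpa [(hf t ht h0).1] using (hf t ht h0).2
    _ = #{t ∈ T | p t} * μ := by simp [← sum_filter]
    _ ≤ r * μ := mul_le_mul_of_nonneg_right (hcard ▸ hr) hμ


/-- ERC in the convolutional sparse model: if the support `T` has stripe overlap bound `k`
with `k < (1/2)(1 + 1/μ)`, then `G = D_Tᵀ D_T` is invertible and the Exact Recovery Condition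
holds: `‖G⁻¹ D_Tᵀ d_i‖₁ < 1` for every `i ∉ T`. -/
theorem erc_convolutional {N M : ℕ} (D : Matrix (Fin N) (Fin M) ℝ)
    (μ : ℝ) (k : ℕ) (hμ : 0 < μ)
    (hnorm : ∀ j, (∑ x, D x j ^ 2) = 1)
    (hcoh : ∀ i j, i ≠ j → |∑ x, D x i * D x j| ≤ μ)
    (T : Finset (Fin M))
    (hin : ∀ j ∈ T,
      Nat.card {t : Fin M // t ∈ T ∧ t ≠ j ∧ (∑ x, D x t * D x j) ≠ 0} < k)
    (hout : ∀ j ∉ T,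
      Nat.card {t : Fin M // t ∈ T ∧ (∑ x, D x t * D x j) ≠ 0} ≤ k)
    (hk : (k : ℝ) < (1 / 2) * (1 + 1 / μ))
    (G : Matrix {x // x ∈ T} {x // x ∈ T} ℝ)
    (hG : G = Matrix.of fun t s : {x // x ∈ T} => ∑ x, D x t.1 * D x s.1) :
    IsUnit G ∧ ∀ i ∉ T,
      (∑ t : {x // x ∈ T},
        |G⁻¹.mulVec (fun s : {x // x ∈ T} => ∑ x, D x s.1 * D x i) t|) < 1 := by
  have hgap : k * μ < 1 - (k - 1) * μ := by
    have h := mul_lt_mul_of_pos_right hk hμ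
    have hinv : 1 / 2 * (1 + 1 / μ) * μ = 1 / 2 * (μ + 1) := by field_simp
    linarith
  have hkμ : 0 ≤ k * μ := by positivity
  have hcol : ∀ s, ∑ t, |(G - 1) t s| ≤ ((k : ℝ) - 1) * μ := by
    intro s
    have hentry : ∀ t, (G - 1) t s =
        (fun t : Fin M => if t = s.1 then 0 else ∑ x, D x t * D x s.1) t.1 := by
      intro t
      by_cases hts : t = s
      · simp [hG, hts, ← pow_two, hnorm]
      · simp [hG, hts, Subtype.ext_iff.not.mp hts]
    simp only [hentry]
    refine T.sum_abs_subtype_le_card_mul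
      (fun t => t ≠ s.1 ∧ (∑ x, D x t * D x s.1) ≠ 0)
      (fun t => if t = s.1 then 0 else ∑ x, D x t * D x s.1) hμ.le (fun t _ h0 => ?_) ?_
    · by_cases hts : t = s.1
      · simp [hts] at h0
      · simp only [hts, if_false] at h0 ⊢
        exact ⟨⟨hts, h0⟩, hcoh t s hts⟩
    · have h : ((_ + 1 : ℕ) : ℝ) ≤ k := Nat.cast_le.mpr (hin s s.2)
      push_cast at h
      linarith
  have hbound := G.one_sub_mul_sum_abs_le hcol
  have hunit : IsUnit G := by
    rw [← Matrix.mulVec_injective_iff_isUnit, ← Matrix.coe_mulVecLin,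
      injective_iff_map_eq_zero]
    intro x hx
    rw [Matrix.mulVecLin_apply] at hx
    have h := hbound x
    simp only [hx, Pi.zero_apply, abs_zero, Finset.sum_const_zero] at h
    have hsum : ∑ t, |x t| = 0 :=
      le_antisymm (nonpos_of_mul_nonpos_right h (by linarith)) (by positivity)
    funext t
    simpa using (Finset.sum_eq_zero_iff_of_nonneg fun t _ => abs_nonneg (x t)).mp hsum t
      (Finset.mem_univ t)
  refine ⟨hunit, fun i hi => ?_⟩
  have h := hbound (G⁻¹.mulVec fun s : {x // x ∈ T} => ∑ x, D x s.1 * D x i)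
  rw [Matrix.mulVec_mulVec, Matrix.mul_nonsing_inv _ ((Matrix.isUnit_iff_isUnit_det G).mp hunit),
    Matrix.one_mulVec] at h
  have hb : ∑ t : {x // x ∈ T}, |∑ x, D x t.1 * D x i| ≤ k * μ :=
    T.sum_abs_subtype_le_card_mul (fun t => (∑ x, D x t * D x i) ≠ 0)
      (fun t => ∑ x, D x t * D x i) hμ.le
      (fun t ht h0 => ⟨h0, hcoh t i (ne_of_mem_of_not_mem ht hi)⟩) (Nat.cast_le.mpr (hout i hi))
  by_contra! hge
  have hmul := le_mul_of_one_le_right (hkμ.trans hgap.le) hge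
  linarith
end

section
/- Let D be a real N×M matrix with normalized columns d_1,…,d_M (‖d_j‖₂ = 1) and mutual coherence bound μ > 0 (|⟨d_i,d_j⟩| ≤ μ for i ≠ j). Let T ⊆ {1,…,M} satisfy the stripe overlap bound k: for every j ∈ T the number of t ∈ T with t ≠ j and ⟨d_t,d_j⟩ ≠ 0 is at most k − 1, and for every j ∉ T the number of t ∈ T with ⟨d_t,d_j⟩ ≠ 0 is at most k. If k < (1/3)(1 + 1/μ), then the ERC constant of T exceeds one half: θ = 1 − max_{i∉T} ‖G_T^{-1} D_T^T d_i‖₁ > 1/2, where G_T = D_T^T D_T. -/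
/-- A sum of absolute values bounded by `μ` is at most `μ` times the number of nonzero terms. -/
theorem Finset.sum_abs_le_natCard_mul {ι : Type*} (T : Finset ι) (f : ι → ℝ) {μ : ℝ}
    (hf : ∀ t ∈ T, f t ≠ 0 → |f t| ≤ μ) :
    ∑ t ∈ T, |f t| ≤ Nat.card {t : ι // t ∈ T ∧ f t ≠ 0} * μ := by
  classical
  have hcard : Nat.card {t : ι // t ∈ T ∧ f t ≠ 0} = (T.filter fun t => f t ≠ 0).card :=
    Nat.subtype_card _ (by simp)
  have hfilter : ∑ t ∈ T with f t ≠ 0, |f t| = ∑ t ∈ T, |f t| :=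
    Finset.sum_filter_of_ne fun t _ h => by simpa using h
  rw [hcard, ← hfilter, ← nsmul_eq_mul]
  refine Finset.sum_le_card_nsmul _ _ _ fun t ht => ?_
  rw [Finset.mem_filter] at ht
  exact hf t ht.1 ht.2

/-- If the absolute column sums of `A - 1` are at most `a`, then `A` shrinks the `ℓ¹` norm by a
factor of at least `1 - a`. -/
theorem Matrix.one_sub_mul_sum_abs_le_sum_abs_mulVec {n : Type*} [Fintype n] [DecidableEq n]
    (A : Matrix n n ℝ) {a : ℝ} (hA : ∀ s, ∑ t, |(A - 1) t s| ≤ a) (v : n → ℝ) :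
    (1 - a) * ∑ t, |v t| ≤ ∑ t, |A.mulVec v t| := by
  have hrow (t : n) : |v t| ≤ |A.mulVec v t| + ∑ s, |(A - 1) t s| * |v s| := by
    have hsub : v t = A.mulVec v t - ∑ s, (A - 1) t s * v s := by
      change v t = A.mulVec v t - (A - 1).mulVec v t
      simp [Matrix.sub_mulVec]
    calc |v t| ≤ |A.mulVec v t| + |∑ s, (A - 1) t s * v s| := by
          conv_lhs => rw [hsub]
          exact abs_sub _ _
      _ ≤ _ := by
          gcongr
          simpa only [abs_mul] using
            Finset.abs_sum_le_sum_abs (fun s => (A - 1) t s * v s) Finset.univ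
  have hsum : ∑ t, ∑ s, |(A - 1) t s| * |v s| ≤ a * ∑ s, |v s| := by
    rw [Finset.sum_comm, Finset.mul_sum]
    refine Finset.sum_le_sum fun s _ => ?_
    rw [← Finset.sum_mul]
    exact mul_le_mul_of_nonneg_right (hA s) (abs_nonneg _)
  have htotal := Finset.sum_le_sum fun t (_ : t ∈ Finset.univ) => hrow t
  rw [Finset.sum_add_distrib] at htotal
  linarith

/-- A matrix whose distance to the identity has absolute column sums less than one is
invertible. -/
theorem Matrix.isUnit_of_sum_abs_sub_one_le {n : Type*} [Fintype n] [DecidableEq n]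
    (A : Matrix n n ℝ) {a : ℝ} (ha : a < 1) (hA : ∀ s, ∑ t, |(A - 1) t s| ≤ a) :
    IsUnit A := by
  rw [← Matrix.mulVec_injective_iff_isUnit]
  refine (injective_iff_map_eq_zero A.mulVecLin).2 fun v hv => ?_
  have hbound := A.one_sub_mul_sum_abs_le_sum_abs_mulVec hA v
  rw [Matrix.mulVecLin_apply] at hv
  simp only [hv, Pi.zero_apply, abs_zero, Finset.sum_const_zero] at hbound
  have hzero : ∑ t, |v t| = 0 :=
    le_antisymm (nonpos_of_mul_nonpos_right hbound (sub_pos.2 ha))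
      (Finset.sum_nonneg fun t _ => abs_nonneg _)
  ext t
  simpa using (Finset.sum_eq_zero_iff_of_nonneg fun t _ => abs_nonneg (v t)).1 hzero t


/-- If the support `T` has stripe overlap bound `k` with `k < (1/3)(1 + 1/μ)`, then the ERC
constant of `T` exceeds one half: `θ = 1 - max_{i∉T} ‖G⁻¹ D_Tᵀ d_i‖₁ > 1/2`, i.e.
`‖G⁻¹ D_Tᵀ d_i‖₁ < 1/2` for every `i ∉ T`. -/
theorem erc_constant_gt_half {N M : ℕ} (D : Matrix (Fin N) (Fin M) ℝ)
    (μ : ℝ) (k : ℕ) (hμ : 0 < μ)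
    (hnorm : ∀ j, (∑ x, D x j ^ 2) = 1)
    (hcoh : ∀ i j, i ≠ j → |∑ x, D x i * D x j| ≤ μ)
    (T : Finset (Fin M))
    (hin : ∀ j ∈ T,
      Nat.card {t : Fin M // t ∈ T ∧ t ≠ j ∧ (∑ x, D x t * D x j) ≠ 0} < k)
    (hout : ∀ j ∉ T,
      Nat.card {t : Fin M // t ∈ T ∧ (∑ x, D x t * D x j) ≠ 0} ≤ k)
    (hk : (k : ℝ) < (1 / 3) * (1 + 1 / μ))
    (G : Matrix {x // x ∈ T} {x // x ∈ T} ℝ)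
    (hG : G = Matrix.of fun t s : {x // x ∈ T} => ∑ x, D x t.1 * D x s.1) :
    IsUnit G ∧ ∀ i ∉ T,
      (∑ t : {x // x ∈ T},
        |G⁻¹.mulVec (fun s : {x // x ∈ T} => ∑ x, D x s.1 * D x i) t|) < 1 / 2 := by
  have hkμ : 3 * (k * μ) < μ + 1 := by
    have h := mul_lt_mul_of_pos_right hk hμ
    have hexpand : (1 / 3) * (1 + 1 / μ) * μ = (μ + 1) / 3 := by field_simp
    linarith
  have ha : ((k : ℝ) - 1) * μ < 1 := by linarith
  have hcol : ∀ s, ∑ t, |(G - 1) t s| ≤ ((k : ℝ) - 1) * μ := by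
    rintro ⟨j, hj⟩
    let f : Fin M → ℝ := fun t => if t = j then 0 else ∑ x, D x t * D x j
    have hentry (t : {x // x ∈ T}) : (G - 1) t ⟨j, hj⟩ = f t := by
      by_cases h : t.1 = j
      · obtain rfl : t = ⟨j, hj⟩ := Subtype.ext h
        simp [hG, f, ← pow_two, hnorm]
      · have hne : t ≠ ⟨j, hj⟩ := fun e => h (congrArg Subtype.val e)
        simp [hG, f, h, Matrix.one_apply_ne hne]
    have hcard : Nat.card {t : Fin M // t ∈ T ∧ f t ≠ 0} < k := by
      simpa [f] using hin j hj
    have hcard' : (Nat.card {t : Fin M // t ∈ T ∧ f t ≠ 0} : ℝ) ≤ k - 1 := by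
      have : (Nat.card {t : Fin M // t ∈ T ∧ f t ≠ 0} : ℝ) + 1 ≤ k := by exact_mod_cast hcard
      linarith
    simp only [hentry]
    rw [Finset.sum_coe_sort T fun t => |f t|]
    refine (T.sum_abs_le_natCard_mul f (μ := μ) fun t _ _ => ?_).trans
      (mul_le_mul_of_nonneg_right hcard' hμ.le)
    by_cases h : t = j
    · simp [f, h, hμ.le]
    · simpa [f, h] using hcoh t j h
  have hunit : IsUnit G := G.isUnit_of_sum_abs_sub_one_le ha hcol
  refine ⟨hunit, fun i hi => ?_⟩
  have hcorr : ∑ s : {x // x ∈ T}, |∑ x, D x s.1 * D x i| ≤ k * μ := by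
    rw [Finset.sum_coe_sort T fun s => |∑ x, D x s * D x i|]
    refine (T.sum_abs_le_natCard_mul (fun s => ∑ x, D x s * D x i) fun t ht _ =>
      hcoh t i fun e => hi (e ▸ ht)).trans ?_
    exact mul_le_mul_of_nonneg_right (by exact_mod_cast hout i hi) hμ.le
  have hbound := G.one_sub_mul_sum_abs_le_sum_abs_mulVec hcol
    (G⁻¹.mulVec fun s : {x // x ∈ T} => ∑ x, D x s.1 * D x i)
  rw [Matrix.mulVec_mulVec, Matrix.mul_nonsing_inv G ((Matrix.isUnit_iff_isUnit_det G).1 hunit),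
    Matrix.one_mulVec] at hbound
  refine lt_of_mul_lt_mul_left (a := 1 - ((k : ℝ) - 1) * μ) ?_ (sub_pos.2 ha).le
  linarith
end

section
/- Let D be a real N×M matrix with normalized columns d_1,…,d_M (‖d_j‖₂ = 1) and mutual coherence bound μ (|⟨d_i,d_j⟩| ≤ μ for i ≠ j). Let T ⊆ {1,…,M} satisfy the stripe overlap bound k: for every j ∈ T the number of t ∈ T with t ≠ j and ⟨d_t,d_j⟩ ≠ 0 is at most k − 1, and for every j ∉ T the number of t ∈ T with ⟨d_t,d_j⟩ ≠ 0 is at most k; assume k < (1/2)(1 + 1/μ). Let E ∈ ℝ^N satisfy |⟨d_t, E⟩| ≤ ε_L for every t ∈ T. Then for every i ∉ T, |⟨d_i, D_T G_T^{-1} D_T^T E⟩| < ε_L, where G_T = D_T^T D_T. -/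
/-- A finite family bounded by `μ` in absolute value has `ℓ₁` norm at most `μ` times any bound
on the number of its nonzero terms. -/
theorem sum_abs_le_of_card_support_le {ι : Type*} (S : Finset ι) (f : ι → ℝ) (μ : ℝ) (n : ℕ)
    (hμ : 0 ≤ μ) (hf : ∀ s ∈ S, |f s| ≤ μ) (hn : (S.filter fun s => f s ≠ 0).card ≤ n) :
    ∑ s ∈ S, |f s| ≤ n * μ := by
  have h : ∑ s ∈ S, |f s| = ∑ s ∈ S.filter (fun s => f s ≠ 0), |f s| := by
    rw [Finset.sum_filter]
    refine Finset.sum_congr rfl fun s _ => ?_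
    by_cases hs : f s = 0 <;> simp [hs]
  rw [h]
  calc _ ≤ ∑ s ∈ S.filter (fun s => f s ≠ 0), μ :=
        Finset.sum_le_sum fun s hs => hf s (Finset.mem_filter.1 hs).1
    _ = ((S.filter fun s => f s ≠ 0).card : ℝ) * μ := by simp
    _ ≤ n * μ := by gcongr

/-- Ahlberg–Nilson–Varah bound: a matrix with unit diagonal whose off-diagonal rows have `ℓ₁` norm
at most `r < 1` satisfies `‖A⁻¹ b‖_∞ ≤ ‖b‖_∞ / (1 - r)`. -/
theorem abs_inv_mulVec_mul_le {ι : Type*} [Fintype ι] [DecidableEq ι] (A : Matrix ι ι ℝ)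
    (r ε : ℝ) (hr : r < 1) (hdiag : ∀ t, A t t = 1)
    (hrow : ∀ t, ∑ s ∈ Finset.univ.erase t, |A t s| ≤ r) (b : ι → ℝ) (hb : ∀ t, |b t| ≤ ε)
    (s : ι) : |A⁻¹.mulVec b s| * (1 - r) ≤ ε := by
  have hdet : IsUnit A.det := by
    refine isUnit_iff_ne_zero.2 (det_ne_zero_of_sum_row_lt_diag fun t => ?_)
    simpa [hdiag] using (hrow t).trans_lt hr
  set c := A⁻¹.mulVec b with hc
  have hAc : A.mulVec c = b := by
    rw [hc, Matrix.mulVec_mulVec, Matrix.mul_nonsing_inv _ hdet, Matrix.one_mulVec]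
  obtain ⟨t, -, ht⟩ := Finset.exists_max_image Finset.univ (fun s => |c s|) ⟨s, Finset.mem_univ s⟩
  have heq : c t + ∑ s ∈ Finset.univ.erase t, A t s * c s = b t := by
    rw [← hAc, Matrix.mulVec, dotProduct, ← Finset.add_sum_erase _ _ (Finset.mem_univ t), hdiag,
      one_mul]
  have hoff : |∑ s ∈ Finset.univ.erase t, A t s * c s| ≤ r * |c t| :=
    calc _ ≤ ∑ s ∈ Finset.univ.erase t, |A t s * c s| := Finset.abs_sum_le_sum_abs _ _
      _ ≤ ∑ s ∈ Finset.univ.erase t, |A t s| * |c t| := by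
        refine Finset.sum_le_sum fun s _ => ?_
        rw [abs_mul]
        exact mul_le_mul_of_nonneg_left (ht s (Finset.mem_univ s)) (abs_nonneg _)
      _ ≤ r * |c t| := by
        rw [← Finset.sum_mul]
        exact mul_le_mul_of_nonneg_right (hrow t) (abs_nonneg _)
  have hct : |c t| ≤ |b t| + |∑ s ∈ Finset.univ.erase t, A t s * c s| := by
    rw [eq_sub_of_add_eq heq]
    exact abs_sub _ _
  have hs : |c s| * (1 - r) ≤ |c t| * (1 - r) :=
    mul_le_mul_of_nonneg_right (ht s (Finset.mem_univ s)) (by linarith)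
  linarith [hb t]


/-- Projected noise correlation bound: under the stripe overlap bounds and
`k < (1/2)(1 + 1/μ)`, for every `i ∉ T` the correlation of `d_i` with the orthogonal
projection `D_T G⁻¹ D_Tᵀ E` of the noise onto the span of the support atoms is strictly
smaller than `ε_L`. -/
theorem projected_noise_correlation {N M : ℕ} (D : Matrix (Fin N) (Fin M) ℝ)
    (μ εL : ℝ) (k : ℕ) (hμ : 0 ≤ μ) (hεL : 0 < εL)
    (hnorm : ∀ j, (∑ x, D x j ^ 2) = 1)
    (hcoh : ∀ i j, i ≠ j → |∑ x, D x i * D x j| ≤ μ)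
    (T : Finset (Fin M))
    (hin : ∀ j ∈ T,
      Nat.card {t : Fin M // t ∈ T ∧ t ≠ j ∧ (∑ x, D x t * D x j) ≠ 0} < k)
    (hout : ∀ j ∉ T,
      Nat.card {t : Fin M // t ∈ T ∧ (∑ x, D x t * D x j) ≠ 0} ≤ k)
    (hk : (k : ℝ) < (1 / 2) * (1 + 1 / μ))
    (E : Fin N → ℝ) (hE : ∀ t ∈ T, |∑ x, D x t * E x| ≤ εL)
    (G : Matrix {x // x ∈ T} {x // x ∈ T} ℝ)
    (hG : G = Matrix.of fun t s : {x // x ∈ T} => ∑ x, D x t.1 * D x s.1) :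
    ∀ i ∉ T,
      |∑ x, D x i * (∑ t : {a // a ∈ T},
        G⁻¹.mulVec (fun s : {a // a ∈ T} => ∑ y, D y s.1 * E y) t * D x t.1)| < εL := by
  intro i hi
  rcases T.eq_empty_or_nonempty with rfl | ⟨j₀, hj₀⟩
  · simpa using hεL
  have hk1 : 1 ≤ k := Nat.one_le_iff_ne_zero.2 (Nat.ne_zero_of_lt (hin j₀ hj₀))
  have hk1' : (1 : ℝ) ≤ k := by exact_mod_cast hk1
  have hkμ : (2 * k - 1) * μ < 1 := by
    rcases hμ.eq_or_lt with rfl | hpos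
    · simp
    · rw [← lt_div_iff₀ hpos]
      linarith
  have hr : (k - 1 : ℝ) * μ < 1 := by nlinarith
  have hrow : ∀ t : {x // x ∈ T}, ∑ s ∈ Finset.univ.erase t, |G t s| ≤ (k - 1 : ℝ) * μ := by
    intro t
    rw [← Nat.cast_pred hk1]
    refine sum_abs_le_of_card_support_le _ _ μ (k - 1) hμ (fun s hs => ?_) ?_
    · rw [hG]
      exact hcoh _ _ fun h => (Finset.ne_of_mem_erase hs) (Subtype.ext h.symm)
    · refine le_trans ?_ (Nat.le_pred_of_lt (hin t t.2))
      rw [Nat.card_eq_fintype_card, Fintype.card_subtype]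
      refine Finset.card_le_card_of_injOn Subtype.val (fun s hs => ?_)
        Subtype.val_injective.injOn
      simp only [hG, Finset.coe_filter, Finset.mem_erase, Finset.mem_univ, and_true,
        Matrix.of_apply, Set.mem_ofPred_eq] at hs
      simp only [Finset.coe_filter, Finset.mem_univ, true_and, Set.mem_ofPred_eq]
      refine ⟨s.2, fun h => hs.1 (Subtype.ext h), ?_⟩
      simpa only [mul_comm] using hs.2
  have hc := abs_inv_mulVec_mul_le G _ εL hr
    (fun t => by simpa [hG, ← sq] using hnorm t) hrow
    (fun s : {a // a ∈ T} => ∑ y, D y s.1 * E y) (fun t => hE t t.2)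
  set c := G⁻¹.mulVec (fun s : {a // a ∈ T} => ∑ y, D y s.1 * E y)
  have hcross : ∑ t : {a // a ∈ T}, |∑ x, D x t.1 * D x i| ≤ k * μ := by
    refine sum_abs_le_of_card_support_le _ _ μ k hμ (fun s _ => ?_) ?_
    · exact hcoh _ _ fun h => hi (h ▸ s.2)
    · refine le_trans ?_ (hout i hi)
      rw [Nat.card_eq_fintype_card, Fintype.card_subtype]
      refine Finset.card_le_card_of_injOn Subtype.val (fun s hs => ?_)
        Subtype.val_injective.injOn
      simp only [Finset.coe_filter, Finset.mem_univ, true_and, Set.mem_ofPred_eq] at hs ⊢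
      exact ⟨s.2, hs⟩
  have hswap : ∑ x, D x i * (∑ t : {a // a ∈ T}, c t * D x t.1)
      = ∑ t : {a // a ∈ T}, (∑ x, D x t.1 * D x i) * c t := by
    simp only [Finset.mul_sum, Finset.sum_mul]
    rw [Finset.sum_comm]
    exact Finset.sum_congr rfl fun t _ => Finset.sum_congr rfl fun x _ => by ring
  rw [hswap]
  have hpos : 0 < 1 - (k - 1 : ℝ) * μ := by linarith
  calc _ ≤ ∑ t : {a // a ∈ T}, |(∑ x, D x t.1 * D x i) * c t| := Finset.abs_sum_le_sum_abs _ _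
    _ ≤ ∑ t : {a // a ∈ T}, |∑ x, D x t.1 * D x i| * (εL / (1 - (k - 1 : ℝ) * μ)) := by
      refine Finset.sum_le_sum fun t _ => ?_
      rw [abs_mul]
      exact mul_le_mul_of_nonneg_left ((le_div_iff₀ hpos).2 (hc t)) (abs_nonneg _)
    _ ≤ (k * μ) * (εL / (1 - (k - 1 : ℝ) * μ)) := by
      rw [← Finset.sum_mul]
      gcongr
    _ < εL := by
      rw [← mul_div_assoc, div_lt_iff₀ hpos, mul_comm]
      exact mul_lt_mul_of_pos_left (by linarith) hεL
end

section
/- (Lemma 1: correlation of the least-squares residual.) Let D be a real N×M matrix with normalized columns d_1,…,d_M (‖d_j‖₂ = 1) and mutual coherence bound μ (|⟨d_i,d_j⟩| ≤ μ for i ≠ j). Let Γ ∈ ℝ^M with support T = supp(Γ), and suppose T satisfies the stripe overlap bound k: for every j ∈ T the number of t ∈ T with t ≠ j and ⟨d_t,d_j⟩ ≠ 0 is at most k − 1, and for every j ∉ T the number of t ∈ T with ⟨d_t,d_j⟩ ≠ 0 is at most k; assume k < (1/2)(1 + 1/μ). Let E ∈ ℝ^N satisfy |⟨d_j, E⟩|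 ≤ ε_L for every j ∈ {1,…,M}, and set Y = DΓ + E. Let X_LS = D_T G_T^{-1} D_T^T Y be the orthogonal projection of Y onto the span of the columns of D_T, where G_T = D_T^T D_T. Then ‖D^T (Y − X_LS)‖_∞ ≤ 2ε_L, i.e. |⟨d_j, Y − X_LS⟩| ≤ 2ε_L for every j ∈ {1,…,M}. -/
open Finset in
/-- A sum with at most `m` nonzero coefficients, each bounded by `μ`, against values bounded
by `A`, is at most `m * (μ * A)`. -/
lemma abs_sum_mul_le_of_card_support_le {ι : Type*} (S : Finset ι) (f a : ι → ℝ) (μ A : ℝ)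
    (m : ℕ) (hμ : 0 ≤ μ) (hA : 0 ≤ A) (hf : ∀ t ∈ S, |f t| ≤ μ) (ha : ∀ t ∈ S, |a t| ≤ A)
    (hcard : Nat.card {t : ι // t ∈ S ∧ f t ≠ 0} ≤ m) :
    |∑ t ∈ S, f t * a t| ≤ m * (μ * A) := by
  classical
  have hc : (S.filter fun t => f t ≠ 0).card ≤ m := by
    rwa [← Nat.subtype_card (S.filter fun t => f t ≠ 0) fun t => mem_filter]
  have hs : ∑ t ∈ S, f t * a t = ∑ t ∈ S with f t ≠ 0, f t * a t := by
    refine (sum_filter_of_ne fun t _ h => ?_).symm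
    exact left_ne_zero_of_mul h
  rw [hs]
  calc |∑ t ∈ S with f t ≠ 0, f t * a t|
      ≤ ∑ t ∈ S with f t ≠ 0, |f t * a t| := abs_sum_le_sum_abs _ _
    _ ≤ ∑ t ∈ S with f t ≠ 0, μ * A := by
        refine sum_le_sum fun t ht => ?_
        have ht := (mem_filter.mp ht).1
        rw [abs_mul]
        exact mul_le_mul (hf t ht) (ha t ht) (abs_nonneg _) hμ
    _ = (S.filter fun t => f t ≠ 0).card * (μ * A) := by rw [sum_const, nsmul_eq_mul]
    _ ≤ m * (μ * A) := by gcongr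

open Finset in
/-- Sup-norm bound for the solution of a diagonally dominant linear system with unit diagonal. -/
lemma abs_solution_mul_le {ι : Type*} [DecidableEq ι] (T : Finset ι) (H : ι → ι → ℝ) (μ ε : ℝ)
    (k : ℕ) (hμ : 0 ≤ μ) (hε : 0 ≤ ε) (hdiag : ∀ j, H j j = 1)
    (hcoh : ∀ i j, i ≠ j → |H i j| ≤ μ)
    (hin : ∀ j ∈ T, Nat.card {t : ι // t ∈ T ∧ t ≠ j ∧ H t j ≠ 0} < k)
    (a : ι → ℝ) (ha : ∀ s ∈ T, |∑ t ∈ T, H t s * a t| ≤ ε) :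
    ∃ A, 0 ≤ A ∧ (∀ t ∈ T, |a t| ≤ A) ∧ (1 - (k - 1) * μ) * A ≤ ε := by
  rcases T.eq_empty_or_nonempty with rfl | hne
  · exact ⟨0, le_rfl, by simp, by simpa using hε⟩
  obtain ⟨s, hs, hmax⟩ := exists_max_image T (fun t => |a t|) hne
  refine ⟨|a s|, abs_nonneg _, hmax, ?_⟩
  have hlt := hin s hs
  have hoff : |∑ t ∈ T.erase s, H t s * a t| ≤ ((k - 1 : ℕ) : ℝ) * (μ * |a s|) := by
    refine abs_sum_mul_le_of_card_support_le _ (fun t => H t s) a μ _ _ hμ (abs_nonneg _)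
      (fun t ht => hcoh t s (ne_of_mem_erase ht)) (fun t ht => hmax t (mem_of_mem_erase ht)) ?_
    have : Nat.card {t : ι // t ∈ T.erase s ∧ H t s ≠ 0} =
        Nat.card {t : ι // t ∈ T ∧ t ≠ s ∧ H t s ≠ 0} :=
      Nat.card_congr (Equiv.subtypeEquivRight fun t => by rw [mem_erase]; tauto)
    omega
  rw [Nat.cast_sub (by omega), Nat.cast_one] at hoff
  have hsum := ha s hs
  rw [← add_sum_erase T _ hs, hdiag, one_mul] at hsum
  have htri := abs_sub (a s + ∑ t ∈ T.erase s, H t s * a t) (∑ t ∈ T.erase s, H t s * a t)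
  rw [add_sub_cancel_right] at htri
  linarith


/-- Lemma 1: correlation of the least-squares residual. If `T = supp(Γ)` has stripe overlap
bound `k` with `k < (1/2)(1 + 1/μ)`, `Y = DΓ + E` with `|⟨d_j, E⟩| ≤ ε_L` for all `j`, and
`X_LS = D_T G⁻¹ D_Tᵀ Y` is the orthogonal projection of `Y` onto the span of the support
atoms, then `‖Dᵀ(Y - X_LS)‖_∞ ≤ 2ε_L`. -/
theorem residual_correlation_bound {N M : ℕ} (D : Matrix (Fin N) (Fin M) ℝ)
    (μ εL : ℝ) (k : ℕ) (hμ : 0 ≤ μ)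
    (hnorm : ∀ j, (∑ x, D x j ^ 2) = 1)
    (hcoh : ∀ i j, i ≠ j → |∑ x, D x i * D x j| ≤ μ)
    (Γ : Fin M → ℝ) (T : Finset (Fin M)) (hT : ∀ i, Γ i ≠ 0 ↔ i ∈ T)
    (hin : ∀ j ∈ T,
      Nat.card {t : Fin M // t ∈ T ∧ t ≠ j ∧ (∑ x, D x t * D x j) ≠ 0} < k)
    (hout : ∀ j ∉ T,
      Nat.card {t : Fin M // t ∈ T ∧ (∑ x, D x t * D x j) ≠ 0} ≤ k)
    (hk : (k : ℝ) < (1 / 2) * (1 + 1 / μ))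
    (E Y : Fin N → ℝ)
    (hE : ∀ j, |∑ x, D x j * E x| ≤ εL)
    (hY : ∀ x, Y x = D.mulVec Γ x + E x)
    (G : Matrix {x // x ∈ T} {x // x ∈ T} ℝ)
    (hG : G = Matrix.of fun t s : {x // x ∈ T} => ∑ x, D x t.1 * D x s.1)
    (XLS : Fin N → ℝ)
    (hXLS : ∀ x, XLS x = ∑ t : {a // a ∈ T},
      G⁻¹.mulVec (fun s : {a // a ∈ T} => ∑ y, D y s.1 * Y y) t * D x t.1) :
    ∀ j, |∑ x, D x j * (Y x - XLS x)| ≤ 2 * εL := by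
  classical
  set H : Fin M → Fin M → ℝ := fun i j => ∑ x, D x i * D x j with hH
  have hsymm : ∀ i j, H i j = H j i := fun i j => by simp only [hH, mul_comm]
  have hdiag : ∀ j, H j j = 1 := fun j => by simp only [hH, ← sq, hnorm]
  intro j
  have hε : 0 ≤ εL := (abs_nonneg _).trans (hE j)
  have hkμ : 2 * (k * μ) ≤ 1 + μ := by
    rcases hμ.eq_or_lt with rfl | hpos
    · norm_num
    · have h := mul_lt_mul_of_pos_right hk hpos
      have : 1 / 2 * (1 + 1 / μ) * μ = (1 + μ) / 2 := by field_simp; ring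
      linarith
  have hdom : (k - 1) * μ < 1 := by linarith
  have hker : ∀ v, G.mulVec v = 0 → v = 0 := by
    intro v hv
    set w : Fin M → ℝ := fun i => if h : i ∈ T then v ⟨i, h⟩ else 0 with hw
    have hwv : ∀ t : {x // x ∈ T}, w t.1 = v t := fun t => by simp [hw]
    obtain ⟨A, hA, hwA, hAε⟩ := abs_solution_mul_le T H μ 0 k hμ le_rfl hdiag hcoh hin w (by
      intro s hs
      have h := congrFun hv ⟨s, hs⟩
      simp only [Matrix.mulVec, dotProduct, hG, Matrix.of_apply, Pi.zero_apply] at h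
      rw [← Finset.sum_coe_sort]
      simp only [hwv, hsymm _ s]
      exact (abs_eq_zero.mpr h).le)
    have hA0 : A = 0 := by nlinarith
    funext t
    have h := hwA t.1 t.2
    rw [hA0, hwv] at h
    exact abs_eq_zero.mp (le_antisymm h (abs_nonneg _))
  have hunit : IsUnit G.det := by
    rw [← Matrix.isUnit_iff_isUnit_det, ← Matrix.mulVec_injective_iff_isUnit]
    intro u v huv
    exact sub_eq_zero.mp (hker _ (by rw [Matrix.mulVec_sub]; exact sub_eq_zero.mpr huv))
  set b : {x // x ∈ T} → ℝ := fun s => ∑ y, D y s.1 * Y y with hb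
  set c := G⁻¹.mulVec b with hc
  have hGc : G.mulVec c = b := by
    rw [hc, Matrix.mulVec_mulVec, Matrix.mul_nonsing_inv _ hunit, Matrix.one_mulVec]
  set a : Fin M → ℝ := fun i => if h : i ∈ T then c ⟨i, h⟩ - Γ i else 0 with ha
  have hac : ∀ t : {x // x ∈ T}, a t.1 = c t - Γ t.1 := fun t => by simp [ha]
  have hΓ : ∀ i, ∑ y, D y i * D.mulVec Γ y = ∑ t ∈ T, H t i * Γ t := by
    intro i
    have hsupp : ∑ t ∈ T, H t i * Γ t = ∑ t, H t i * Γ t := by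
      refine Finset.sum_subset (Finset.subset_univ _) fun t _ ht => ?_
      have : Γ t = 0 := by_contra fun h => ht ((hT t).mp h)
      rw [this, mul_zero]
    rw [hsupp]
    simp only [Matrix.mulVec, dotProduct, hH, Finset.mul_sum, Finset.sum_mul]
    rw [Finset.sum_comm]
    exact Finset.sum_congr rfl fun _ _ => Finset.sum_congr rfl fun _ _ => by ring
  have hDY : ∀ i, ∑ y, D y i * Y y = ∑ t ∈ T, H t i * Γ t + ∑ y, D y i * E y := by
    intro i
    simp only [hY, mul_add, Finset.sum_add_distrib, hΓ]
  have hDX : ∀ i, ∑ y, D y i * XLS y = ∑ t : {x // x ∈ T}, H t.1 i * c t := by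
    intro i
    simp only [hXLS, hH, Finset.mul_sum, Finset.sum_mul]
    rw [Finset.sum_comm]
    exact Finset.sum_congr rfl fun _ _ => Finset.sum_congr rfl fun _ _ => by ring
  have hHa : ∀ i, ∑ t ∈ T, H t i * a t =
      ∑ t : {x // x ∈ T}, H t.1 i * c t - ∑ t ∈ T, H t i * Γ t := by
    intro i
    rw [← Finset.sum_coe_sort T (fun t => H t i * a t),
      ← Finset.sum_coe_sort T (fun t => H t i * Γ t), ← Finset.sum_sub_distrib]
    exact Finset.sum_congr rfl fun t _ => by rw [hac, mul_sub]
  have hres : ∀ i, ∑ x, D x i * (Y x - XLS x) =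
      ∑ x, D x i * E x - ∑ t ∈ T, H t i * a t := by
    intro i
    simp only [mul_sub, Finset.sum_sub_distrib]
    rw [hDY, hDX, hHa]
    ring
  have hnormal : ∀ s ∈ T, ∑ t ∈ T, H t s * a t = ∑ x, D x s * E x := by
    intro s hs
    have h := congrFun hGc ⟨s, hs⟩
    simp only [Matrix.mulVec, dotProduct, hG, Matrix.of_apply, hb] at h
    change ∑ t : {x // x ∈ T}, H s t.1 * c t = _ at h
    rw [hDY] at h
    simp only [hsymm s] at h
    rw [hHa, h]
    ring
  rw [hres]
  by_cases hj : j ∈ T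
  · rw [hnormal j hj, sub_self, abs_zero]
    linarith
  · obtain ⟨A, hA, haA, hAε⟩ := abs_solution_mul_le T H μ εL k hμ hε hdiag hcoh hin a
      fun s hs => by rw [hnormal s hs]; exact hE s
    have hcross : |∑ t ∈ T, H t j * a t| ≤ k * (μ * A) :=
      abs_sum_mul_le_of_card_support_le T (fun t => H t j) a μ A k hμ hA
        (fun t ht => hcoh t j fun h => hj (h ▸ ht)) haA (hout j hj)
    have htri := abs_sub (∑ x, D x j * E x) (∑ t ∈ T, H t j * a t)
    have := hE j
    have := mul_le_mul_of_nonneg_right hkμ hA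
    linarith
end

section
/- Let D be a real N×M matrix with normalized columns d_1,…,d_M (‖d_j‖₂ = 1) and mutual coherence bound μ > 0 (|⟨d_i,d_j⟩| ≤ μ for i ≠ j). Let T ⊆ {1,…,M} satisfy: for every j ∈ T the number of t ∈ T with t ≠ j and ⟨d_t,d_j⟩ ≠ 0 is at most k − 1, with k < (1/3)(1 + 1/μ). Let Γ_T ∈ ℝ^T, let E ∈ ℝ^N satisfy |⟨d_t, E⟩| ≤ ε_L for every t ∈ T, and set Y = D_T Γ_T + E. Then the least-squares solution Γ_LS = G_T^{-1} D_T^T Y, where G_T = D_T^T D_T, satisfies ‖Γ_LS − Γ_T‖_∞ < (3/2)·ε_L. -/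
/-- A unit-diagonal matrix whose off-diagonal absolute row sums are below `1/3` has an inverse of
`ℓ∞` norm less than `3/2`: a bound `ε` on `A v` gives the bound `(3/2)ε` on `v`. -/
lemma abs_lt_of_abs_mulVec_le {ι : Type*} [Fintype ι] [DecidableEq ι] (A : Matrix ι ι ℝ)
    (hdiag : ∀ i, A i i = 1) (hoff : ∀ i, ∑ j ∈ Finset.univ.erase i, |A i j| < 1 / 3)
    (v : ι → ℝ) (ε : ℝ) (hε : 0 < ε) (hv : ∀ i, |A.mulVec v i| ≤ ε) (i : ι) :
    |v i| < 3 / 2 * ε := by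
  obtain ⟨m, -, hm⟩ := Finset.exists_max_image Finset.univ (fun j => |v j|) ⟨i, Finset.mem_univ i⟩
  refine (hm i (Finset.mem_univ i)).trans_lt ?_
  have hsplit : A.mulVec v m = v m + ∑ j ∈ Finset.univ.erase m, A m j * v j := by
    rw [Matrix.mulVec, dotProduct, ← Finset.add_sum_erase _ _ (Finset.mem_univ m), hdiag, one_mul]
  have hsum : |∑ j ∈ Finset.univ.erase m, A m j * v j|
      ≤ (∑ j ∈ Finset.univ.erase m, |A m j|) * |v m| := by
    rw [Finset.sum_mul]
    refine (Finset.abs_sum_le_sum_abs _ _).trans (Finset.sum_le_sum fun j _ => ?_)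
    rw [abs_mul]
    exact mul_le_mul_of_nonneg_left (hm j (Finset.mem_univ j)) (abs_nonneg _)
  have htri : |v m| ≤ |A.mulVec v m| + |∑ j ∈ Finset.univ.erase m, A m j * v j| := by
    rw [eq_sub_of_add_eq hsplit.symm]
    exact abs_sub _ _
  have hvm := hv m
  rcases (abs_nonneg (v m)).eq_or_lt with h0 | hpos
  · rw [← h0]; positivity
  · have := mul_lt_mul_of_pos_right (hoff m) hpos
    linarith


/-- `ℓ∞` error of the least-squares coefficients: if the support `T` has stripe overlap bound
`k` with `k < (1/3)(1 + 1/μ)`, `Y = D_T Γ_T + E` and `|⟨d_t, E⟩| ≤ ε_L` for all `t ∈ T`, then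
the least-squares solution `Γ_LS = G⁻¹ D_Tᵀ Y` satisfies `‖Γ_LS - Γ_T‖_∞ < (3/2)ε_L`. -/
theorem least_squares_linfty_error {N M : ℕ} (D : Matrix (Fin N) (Fin M) ℝ)
    (μ εL : ℝ) (k : ℕ) (hμ : 0 < μ) (hεL : 0 < εL)
    (hnorm : ∀ j, (∑ x, D x j ^ 2) = 1)
    (hcoh : ∀ i j, i ≠ j → |∑ x, D x i * D x j| ≤ μ)
    (T : Finset (Fin M))
    (hin : ∀ j ∈ T,
      Nat.card {t : Fin M // t ∈ T ∧ t ≠ j ∧ (∑ x, D x t * D x j) ≠ 0} < k)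
    (hk : (k : ℝ) < (1 / 3) * (1 + 1 / μ))
    (ΓT : {x // x ∈ T} → ℝ) (E Y : Fin N → ℝ)
    (hE : ∀ t ∈ T, |∑ x, D x t * E x| ≤ εL)
    (hY : ∀ x, Y x = (∑ t : {x // x ∈ T}, ΓT t * D x t.1) + E x)
    (G : Matrix {x // x ∈ T} {x // x ∈ T} ℝ)
    (hG : G = Matrix.of fun t s : {x // x ∈ T} => ∑ x, D x t.1 * D x s.1) :
    ∀ t : {x // x ∈ T},
      |G⁻¹.mulVec (fun s : {x // x ∈ T} => ∑ x, D x s.1 * Y x) t - ΓT t|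
        < (3 / 2) * εL := by
  have hentry : ∀ i j, G i j = ∑ x, D x i.1 * D x j.1 := fun i j => by
    rw [hG, Matrix.of_apply]
  have hdiag : ∀ i, G i i = 1 := fun i => by
    simp only [hentry, ← hnorm i.1, sq]
  have hoff : ∀ i, ∑ j ∈ Finset.univ.erase i, |G i j| < 1 / 3 := by
    intro i
    have hcard : ((Finset.univ.erase i).filter fun j => |G i j| ≠ 0).card < k := by
      refine lt_of_le_of_lt ?_ (hin i.1 i.2)
      rw [← Nat.card_eq_finsetCard]
      refine Nat.card_le_card_of_injective
        (fun j => ⟨j.1.1, j.1.2, fun h => ?_, fun h => ?_⟩) fun a b hab => ?_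
      · exact Finset.ne_of_mem_erase (Finset.mem_filter.mp j.2).1 (Subtype.ext h)
      · refine (Finset.mem_filter.mp j.2).2 (abs_eq_zero.mpr ?_)
        rw [hentry]
        refine Eq.trans ?_ h
        exact Finset.sum_congr rfl fun x _ => mul_comm _ _
      · simpa only [Subtype.mk.injEq, Subtype.val_inj] using hab
    have hle : ∑ j ∈ Finset.univ.erase i, |G i j| ≤ ((k : ℝ) - 1) * μ := by
      rw [← Finset.sum_filter_ne_zero]
      refine (Finset.sum_le_card_nsmul _ _ μ fun j hj => ?_).trans ?_
      · have hij : i ≠ j := (Finset.ne_of_mem_erase (Finset.mem_filter.mp hj).1).symm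
        rw [hentry]
        exact hcoh i j fun h => hij (Subtype.ext h)
      · rw [nsmul_eq_mul]
        have : (((Finset.univ.erase i).filter fun j => |G i j| ≠ 0).card : ℝ) + 1 ≤ k := by
          exact_mod_cast hcard
        gcongr
        linarith
    have hkμ : (k : ℝ) * μ < 1 / 3 * (μ + 1) := by
      have := mul_lt_mul_of_pos_right hk hμ
      rwa [mul_assoc, add_mul, one_div_mul_cancel hμ.ne', one_mul] at this
    linarith
  have hdet : IsUnit G.det := by
    refine isUnit_iff_ne_zero.mpr (det_ne_zero_of_sum_row_lt_diag fun i => ?_)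
    have := hoff i
    simp only [Real.norm_eq_abs, hdiag, abs_one]
    linarith
  have hrhs : (fun s : {x // x ∈ T} => ∑ x, D x s.1 * Y x)
      = G.mulVec ΓT + fun s : {x // x ∈ T} => ∑ x, D x s.1 * E x := by
    funext s
    simp only [hentry, hY, Pi.add_apply, Matrix.mulVec, dotProduct, mul_add,
      Finset.sum_add_distrib, Finset.mul_sum, Finset.sum_mul]
    rw [Finset.sum_comm]
    congr 1
    exact Finset.sum_congr rfl fun _ _ => Finset.sum_congr rfl fun _ _ => by ring
  intro t
  refine abs_lt_of_abs_mulVec_le G hdiag hoff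
    (G⁻¹.mulVec (fun s : {x // x ∈ T} => ∑ x, D x s.1 * Y x) - ΓT) εL hεL (fun s => ?_) t
  rw [Matrix.mulVec_sub, Matrix.mulVec_mulVec, Matrix.mul_nonsing_inv _ hdet, Matrix.one_mulVec,
    hrhs, add_sub_cancel_left]
  exact hE s.1 s.2
end
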